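/- The equation (X³ + 11Y³)(X² − XY + Y²)(67²X² − 67·63·XY + 63²Y²)(67²X² − 67·166·XY + 166²Y²)(32²X² − 32·135·XY + 135²Y²) = 1000121⁶ · Z¹¹ defines a non-singular plane projective curve of degree 11, has solutions other than (0,0,0) over ℝ and over ℚ_l for every prime l, but has no solution in rational numbers other than (0,0,0); that is, it violates the local-global principle. -/

import Mathlib

open MvPolynomial

/-- The equation `(X³+aY³) ∏_j (b_j²X² + b_j c_j XY + c_j² Y²) = L Z^n`, evaluated
in a commutative ring `K`; here `bc j = (b_j, c_j)`. -/
def EqnHolds {K : Type} [CommRing K] (a L : ℤ) (n : ℕ) {m : ℕ} (bc : Fin m → ℤ × ℤ)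
    (X Y Z : K) : Prop :=
  (X ^ 3 + (a : K) * Y ^ 3) *
      ∏ j : Fin m, (((bc j).1 : K) ^ 2 * X ^ 2 + ((bc j).1 : K) * ((bc j).2 : K) * X * Y
        + ((bc j).2 : K) ^ 2 * Y ^ 2)
    = (L : K) * Z ^ n

/-- The homogeneous equation `(X³+aY³) ∏_j (b_j²X² + b_j c_j XY + c_j² Y²) = L Z^n`
violates the local-global principle: it has nontrivial solutions over `ℝ` and over `ℚ_l`
for every prime `l`, but only the trivial solution over `ℚ`. -/
def ViolatesLGP (a L : ℤ) (n : ℕ) {m : ℕ} (bc : Fin m → ℤ × ℤ) : Prop :=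
  (∃ X Y Z : ℝ, (X, Y, Z) ≠ (0, 0, 0) ∧ EqnHolds a L n bc X Y Z) ∧
  (∀ (l : ℕ) [Fact l.Prime], ∃ X Y Z : ℚ_[l], (X, Y, Z) ≠ (0, 0, 0) ∧ EqnHolds a L n bc X Y Z) ∧
  (∀ X Y Z : ℚ, EqnHolds a L n bc X Y Z → (X, Y, Z) = (0, 0, 0))

/-- The homogeneous polynomial `(X³+aY³) ∏_j (b_j²X² + b_j c_j XY + c_j² Y²) - L Z^n`
over `ℂ`. -/
noncomputable def curvePoly (a L : ℤ) (n : ℕ) {m : ℕ} (bc : Fin m → ℤ × ℤ) :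
    MvPolynomial (Fin 3) ℂ :=
  (X 0 ^ 3 + C (a : ℂ) * X 1 ^ 3) *
      ∏ j : Fin m, (C (((bc j).1 : ℂ)) ^ 2 * X 0 ^ 2
        + C (((bc j).1 : ℂ)) * C (((bc j).2 : ℂ)) * X 0 * X 1
        + C (((bc j).2 : ℂ)) ^ 2 * X 1 ^ 2)
    - C (L : ℂ) * X 2 ^ n

/-- A homogeneous polynomial `F` defines a non-singular plane projective curve:
`F` and its partial derivatives have no common zero other than the origin over `ℂ`. -/
def IsNonsingular (F : MvPolynomial (Fin 3) ℂ) : Prop :=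
  ∀ v : Fin 3 → ℂ, v ≠ 0 →
    ¬ (eval v F = 0 ∧ ∀ i : Fin 3, eval v (pderiv i F) = 0)

lemma eqnHolds_iff {K : Type} [CommRing K] (X Y Z : K) :
    EqnHolds 11 (1000121 ^ 6) 11 ![(1, -1), (67, -63), (-67, 166), (32, -135)] X Y Z ↔
      (X ^ 3 + 11 * Y ^ 3) * ((X ^ 2 - X * Y + Y ^ 2) *
        (67 ^ 2 * X ^ 2 - 67 * 63 * X * Y + 63 ^ 2 * Y ^ 2) *
        (67 ^ 2 * X ^ 2 - 67 * 166 * X * Y + 166 ^ 2 * Y ^ 2) *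
        (32 ^ 2 * X ^ 2 - 32 * 135 * X * Y + 135 ^ 2 * Y ^ 2)) = 1000121 ^ 6 * Z ^ 11 := by
  unfold EqnHolds
  rw [Fin.prod_univ_four]
  simp only [Matrix.cons_val]
  push_cast
  constructor <;> intro h <;> linear_combination h

lemma exists_real_solution :
    ∃ X Y Z : ℝ, (X, Y, Z) ≠ (0, 0, 0) ∧
      EqnHolds 11 (1000121 ^ 6) 11 ![(1, -1), (67, -63), (-67, 166), (32, -135)] X Y Z := by
  have h : ((67 ^ 4 * 32 ^ 2 / 1000121 ^ 6 : ℝ) ^ ((11 : ℕ) : ℝ)⁻¹) ^ 11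
      = 67 ^ 4 * 32 ^ 2 / 1000121 ^ 6 := Real.rpow_inv_natCast_pow (by positivity) (by norm_num)
  refine ⟨1, 0, (67 ^ 4 * 32 ^ 2 / 1000121 ^ 6 : ℝ) ^ ((11 : ℕ) : ℝ)⁻¹, by simp,
    (eqnHolds_iff _ _ _).2 ?_⟩
  rw [h]
  norm_num

/-- Hensel's lemma for the binomial `b * T ^ n - c`, with an integral approximate root `a`. -/
lemma Padic.exists_mul_pow_eq {l : ℕ} [Fact l.Prime] {n : ℕ} {b c : ℤ} (a : ℤ) (k : ℕ)
    (h : (l : ℤ) ^ (2 * k + 1) ∣ b * a ^ n - c)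
    (h' : ¬ (l : ℤ) ^ (k + 1) ∣ b * (n * a ^ (n - 1))) :
    ∃ z : ℚ_[l], (b : ℚ_[l]) * z ^ n = c := by
  have hl : (1 : ℝ) < l := by exact_mod_cast (Fact.out : l.Prime).one_lt
  rw [← PadicInt.norm_int_le_pow_iff_dvd] at h h'
  rw [PadicInt.norm_le_pow_iff_norm_lt_pow_add_one, not_lt] at h'
  have hF : ‖Polynomial.aeval (a : ℤ_[l])
        (Polynomial.C b * Polynomial.X ^ n - Polynomial.C c)‖ <
      ‖Polynomial.aeval (a : ℤ_[l]) (Polynomial.derivative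
        (Polynomial.C b * Polynomial.X ^ n - Polynomial.C c))‖ ^ 2 := by
    have e1 : Polynomial.aeval (a : ℤ_[l]) (Polynomial.C b * Polynomial.X ^ n - Polynomial.C c)
        = ((b * a ^ n - c : ℤ) : ℤ_[l]) := by simp
    have e2 : Polynomial.aeval (a : ℤ_[l]) (Polynomial.derivative
        (Polynomial.C b * Polynomial.X ^ n - Polynomial.C c))
        = ((b * (n * a ^ (n - 1)) : ℤ) : ℤ_[l]) := by
      simp [Polynomial.derivative_X_pow]
    rw [e1, e2]
    refine h.trans_lt (lt_of_lt_of_le ?_ (pow_le_pow_left₀ (by positivity) h' 2))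
    rw [← zpow_natCast, ← zpow_mul]
    exact zpow_lt_zpow_right₀ hl (by push_cast; omega)
  obtain ⟨z, hz, -⟩ := hensels_lemma hF
  have hz' : (b : ℤ_[l]) * z ^ n = c := by simpa [sub_eq_zero] using hz
  exact ⟨z, by exact_mod_cast congrArg ((↑) : ℤ_[l] → ℚ_[l]) hz'⟩

/-- If `l ≡ 1 [MOD 3]`, then `ℤ_[l]` contains primitive sixth roots of unity. -/
lemma PadicInt.exists_sq_sub_add_one_eq_zero {l : ℕ} [Fact l.Prime] (h : l % 3 = 1) :
    ∃ z : ℤ_[l], z ^ 2 - z + 1 = 0 := by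
  have hl : l.Prime := Fact.out
  have : Fact (Nat.Prime 3) := ⟨Nat.prime_three⟩
  obtain ⟨u, hu⟩ := exists_prime_orderOf_dvd_card (G := (ZMod l)ˣ) 3
    (by rw [ZMod.card_units_eq_totient, Nat.totient_prime hl]; omega)
  obtain ⟨a, ha⟩ := ZMod.intCast_surjective (-(u : ZMod l))
  have h3 : ((u : ZMod l)) ^ 3 = 1 := by
    rw [← Units.val_pow_eq_pow_val, ← hu, pow_orderOf_eq_one, Units.val_one]
  have h1 : (u : ZMod l) - 1 ≠ 0 := by
    intro h0
    have : u = 1 := Units.ext (by simpa [sub_eq_zero] using h0)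
    simp [this] at hu
  have hq : (u : ZMod l) ^ 2 + u + 1 = 0 := by
    refine (mul_eq_zero.1 ?_).resolve_left h1
    linear_combination h3
  have hroot : (l : ℤ) ∣ a ^ 2 - a + 1 := by
    rw [← ZMod.intCast_zmod_eq_zero_iff_dvd]
    push_cast
    rw [ha]
    linear_combination hq
  have hder : ¬ (l : ℤ) ∣ 2 * a - 1 := by
    intro hd
    have h4 : (l : ℤ) ∣ 3 := by
      have := (hroot.mul_left 4).sub (hd.mul_left (2 * a - 1))
      ring_nf at this
      exact this
    have : l = 3 := (Nat.prime_dvd_prime_iff_eq hl Nat.prime_three).1 (by exact_mod_cast h4)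
    omega
  have hF : ‖Polynomial.aeval (a : ℤ_[l])
        (Polynomial.X ^ 2 - Polynomial.X + 1 : Polynomial ℤ)‖ <
      ‖Polynomial.aeval (a : ℤ_[l]) (Polynomial.derivative
        (Polynomial.X ^ 2 - Polynomial.X + 1 : Polynomial ℤ))‖ ^ 2 := by
    have e1 : Polynomial.aeval (a : ℤ_[l]) (Polynomial.X ^ 2 - Polynomial.X + 1 : Polynomial ℤ)
        = ((a ^ 2 - a + 1 : ℤ) : ℤ_[l]) := by simp
    have e2 : Polynomial.aeval (a : ℤ_[l]) (Polynomial.derivative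
        (Polynomial.X ^ 2 - Polynomial.X + 1 : Polynomial ℤ)) = ((2 * a - 1 : ℤ) : ℤ_[l]) := by
      simp only [Polynomial.derivative_add, Polynomial.derivative_sub, Polynomial.derivative_X_pow,
        Polynomial.derivative_X, Polynomial.derivative_one]
      simp [map_ofNat (Polynomial.aeval (a : ℤ_[l])) 2]
    have n2 : ‖((2 * a - 1 : ℤ) : ℤ_[l])‖ = 1 := by
      refine le_antisymm (PadicInt.norm_le_one _) (not_lt.1 ?_)
      rwa [PadicInt.norm_int_lt_one_iff_dvd]
    rw [e1, e2, n2, one_pow, PadicInt.norm_int_lt_one_iff_dvd]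
    exact hroot
  obtain ⟨z, hz, -⟩ := hensels_lemma hF
  exact ⟨z, by simpa using hz⟩

/-- If `l ≡ 2 [MOD 3]`, every integer prime to `l` is a cube in `ℚ_[l]`. -/
lemma Padic.exists_cube_eq {l : ℕ} [Fact l.Prime] (h : l % 3 = 2) {c : ℤ}
    (hc : ¬ (l : ℤ) ∣ c) : ∃ z : ℚ_[l], z ^ 3 = c := by
  have hl : l.Prime := Fact.out
  have hp := Nat.prime_iff_prime_int.1 hl
  obtain ⟨k, hk⟩ : ∃ k, l + (l - 1) = (2 * k + 1) * 3 := ⟨l / 3, by omega⟩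
  have hroot : (l : ℤ) ∣ 1 * (c ^ (2 * k + 1)) ^ 3 - c := by
    rw [← ZMod.intCast_zmod_eq_zero_iff_dvd]
    push_cast
    rw [one_mul, ← pow_mul, ← hk, pow_add, ZMod.pow_card, ← pow_succ',
      Nat.sub_add_cancel hl.one_le, ZMod.pow_card, sub_self]
  have hder : ¬ (l : ℤ) ∣ 1 * ((3 : ℕ) * (c ^ (2 * k + 1)) ^ (3 - 1)) := by
    intro hd
    rw [one_mul] at hd
    rcases hp.dvd_or_dvd hd with h1 | h1
    · have : l = 3 := (Nat.prime_dvd_prime_iff_eq hl Nat.prime_three).1 (by exact_mod_cast h1)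
      omega
    · exact hc (hp.dvd_of_dvd_pow (hp.dvd_of_dvd_pow h1))
  obtain ⟨z, hz⟩ := Padic.exists_mul_pow_eq (l := l) (n := 3) (b := 1) (c := c) (c ^ (2 * k + 1)) 0
    (by simpa using hroot) (by simpa using hder)
  exact ⟨z, by simpa using hz⟩

lemma exists_padic_solution (l : ℕ) [Fact l.Prime] :
    ∃ X Y Z : ℚ_[l], (X, Y, Z) ≠ (0, 0, 0) ∧
      EqnHolds 11 (1000121 ^ 6) 11 ![(1, -1), (67, -63), (-67, 166), (32, -135)] X Y Z := by
  have hl : l.Prime := Fact.out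
  simp only [eqnHolds_iff]
  have h012 : l % 3 = 0 ∨ l % 3 = 1 ∨ l % 3 = 2 := by omega
  rcases h012 with h | h | h
  · obtain rfl : l = 3 := ((Nat.prime_dvd_prime_iff_eq Nat.prime_three hl).1
      (Nat.dvd_of_mod_eq_zero h)).symm
    obtain ⟨z, hz⟩ := Padic.exists_mul_pow_eq (l := 3) (n := 11) (b := 1000121 ^ 6)
      (c := 67 ^ 4 * 32 ^ 2) 1 0 (by norm_num) (by norm_num)
    refine ⟨1, 0, z, by simp, ?_⟩
    norm_num at hz ⊢
    exact hz.symm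
  · obtain ⟨z, hz⟩ := PadicInt.exists_sq_sub_add_one_eq_zero h
    refine ⟨(z : ℚ_[l]), 1, 0, by simp, ?_⟩
    have : (z : ℚ_[l]) ^ 2 - z + 1 = 0 := by exact_mod_cast congrArg ((↑) : ℤ_[l] → ℚ_[l]) hz
    simp [this]
  · by_cases h11 : l = 11
    · subst h11
      obtain ⟨z, hz⟩ := Padic.exists_mul_pow_eq (l := 11) (n := 11) (b := 1000121 ^ 6)
        (c := (1 ^ 3 + 11 * 6 ^ 3) * ((1 ^ 2 - 1 * 6 + 6 ^ 2) *
          (67 ^ 2 * 1 ^ 2 - 67 * 63 * 1 * 6 + 63 ^ 2 * 6 ^ 2) *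
          (67 ^ 2 * 1 ^ 2 - 67 * 166 * 1 * 6 + 166 ^ 2 * 6 ^ 2) *
          (32 ^ 2 * 1 ^ 2 - 32 * 135 * 1 * 6 + 135 ^ 2 * 6 ^ 2))) 38 1
        (by norm_num) (by norm_num)
      refine ⟨1, 6, z, by simp, ?_⟩
      norm_num at hz ⊢
      exact hz.symm
    · obtain ⟨z, hz⟩ := Padic.exists_cube_eq (c := -11) h (by
        rw [Int.dvd_neg]
        exact_mod_cast mt (Nat.prime_dvd_prime_iff_eq hl (by norm_num)).1 h11)
      refine ⟨z, 1, 0, by simp, ?_⟩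
      push_cast at hz
      simp [hz]

lemma isHomogeneous_curvePoly :
    (curvePoly 11 (1000121 ^ 6) 11
      ![(1, -1), (67, -63), (-67, 166), (32, -135)]).IsHomogeneous 11 := by
  unfold curvePoly
  refine IsHomogeneous.sub ?_ ?_
  · have h1 : (X 0 ^ 3 + C ((11 : ℤ) : ℂ) * X 1 ^ 3 : MvPolynomial (Fin 3) ℂ).IsHomogeneous 3 :=
      ((isHomogeneous_X _ _).pow 3).add (((isHomogeneous_X _ _).pow 3).C_mul _)
    refine h1.mul (IsHomogeneous.prod Finset.univ _ (fun _ : Fin 4 => 2) fun j _ => ?_)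
    rw [← C_pow, ← C_mul, ← C_pow, mul_assoc]
    refine IsHomogeneous.add (IsHomogeneous.add ?_ ?_) ?_
    · exact ((isHomogeneous_X _ _).pow 2).C_mul _
    · exact ((isHomogeneous_X _ _).mul (isHomogeneous_X _ _)).C_mul _
    · exact ((isHomogeneous_X _ _).pow 2).C_mul _
  · exact ((isHomogeneous_X _ _).pow 11).C_mul _

lemma totalDegree_curvePoly :
    (curvePoly 11 (1000121 ^ 6) 11
      ![(1, -1), (67, -63), (-67, 166), (32, -135)]).totalDegree = 11 := by
  refine isHomogeneous_curvePoly.totalDegree fun h => ?_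
  have := congrArg (eval ![0, 0, 1]) h
  simp [curvePoly] at this

lemma eq_zero_of_cube_eq_mul_cube {x y r s : ℂ} (hrs : r ≠ s) (h₁ : x ^ 3 = r * y ^ 3)
    (h₂ : x ^ 3 = s * y ^ 3) : x = 0 ∧ y = 0 := by
  have hy : y = 0 := by
    have : (r - s) * y ^ 3 = 0 := by linear_combination h₂ - h₁
    simpa [sub_ne_zero.2 hrs] using this
  exact ⟨by simpa [hy] using h₁, hy⟩

lemma isNonsingular_curvePoly :
    IsNonsingular (curvePoly 11 (1000121 ^ 6) 11
      ![(1, -1), (67, -63), (-67, 166), (32, -135)]) := by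
  rintro v hv ⟨h0, h⟩
  have hx := h 0
  have hy := h 1
  have hz := h 2
  simp only [curvePoly, Fin.prod_univ_four, Matrix.cons_val] at h0 hx hy hz
  simp [Derivation.leibniz, pderiv_X] at h0 hx hy hz
  have hxy : ¬ (v 0 = 0 ∧ v 1 = 0) := fun hxy => hv <| by
    ext i
    fin_cases i
    exacts [hxy.1, hxy.2, hz]
  clear h hv
  generalize v 0 = x at *
  generalize v 1 = y at *
  have key {r s : ℂ} (hrs : r ≠ s) (h₁ : x ^ 3 = r * y ^ 3) (h₂ : x ^ 3 = s * y ^ 3) : False :=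
    hxy (eq_zero_of_cube_eq_mul_cube hrs h₁ h₂)
  have e0 : x ^ 3 + 11 * y ^ 3 = 0 → x ^ 3 = (-11) * y ^ 3 := fun h => by
    linear_combination h
  have e1 : x ^ 2 + -(x * y) + y ^ 2 = 0 → x ^ 3 = (-1) * y ^ 3 := fun h => by
    linear_combination (x + y) * h
  have e2 : 67 ^ 2 * x ^ 2 + -(67 * 63 * x * y) + 63 ^ 2 * y ^ 2 = 0 →
      x ^ 3 = (-(63 / 67) ^ 3) * y ^ 3 := fun h => by
    linear_combination (67 * x + 63 * y) / 67 ^ 3 * h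
  have e3 : 67 ^ 2 * x ^ 2 + -(67 * 166 * x * y) + 166 ^ 2 * y ^ 2 = 0 →
      x ^ 3 = (-(166 / 67) ^ 3) * y ^ 3 := fun h => by
    linear_combination (67 * x + 166 * y) / 67 ^ 3 * h
  have e4 : 32 ^ 2 * x ^ 2 + -(32 * 135 * x * y) + 135 ^ 2 * y ^ 2 = 0 →
      x ^ 3 = (-(135 / 32) ^ 3) * y ^ 3 := fun h => by
    linear_combination (32 * x + 135 * y) / 32 ^ 3 * h
  rw [hz] at h0
  simp only [ne_eq, OfNat.ofNat_ne_zero, not_false_eq_true, zero_pow, mul_zero, sub_zero,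
    mul_eq_zero] at h0
  have lin {b c : ℂ} (hb : b ≠ 0) (hc : c ≠ 0) (h₁ : 2 * b * x = c * y) (h₂ : b * x = 2 * c * y) :
      False := by
    have hx0 : b * x = 0 := by linear_combination (2 * h₁ - h₂) / 3
    have hy0 : c * y = 0 := by linear_combination (h₁ - 2 * h₂) / 3
    exact hxy ⟨(mul_eq_zero.1 hx0).resolve_left hb, (mul_eq_zero.1 hy0).resolve_left hc⟩
  have d01 := fun h h' => key (by norm_num) (e0 h) (e1 h')
  have d02 := fun h h' => key (by norm_num) (e0 h) (e2 h')
  have d03 := fun h h' => key (by norm_num) (e0 h) (e3 h')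
  have d04 := fun h h' => key (by norm_num) (e0 h) (e4 h')
  have d12 := fun h h' => key (by norm_num) (e1 h) (e2 h')
  have d13 := fun h h' => key (by norm_num) (e1 h) (e3 h')
  have d14 := fun h h' => key (by norm_num) (e1 h) (e4 h')
  have d23 := fun h h' => key (by norm_num) (e2 h) (e3 h')
  have d24 := fun h h' => key (by norm_num) (e2 h) (e4 h')
  have d34 := fun h h' => key (by norm_num) (e3 h) (e4 h')
  clear e0 e1 e2 e3 e4 key
  generalize x ^ 3 + 11 * y ^ 3 = f0 at *
  generalize x ^ 2 + -(x * y) + y ^ 2 = f1 at *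
  generalize 67 ^ 2 * x ^ 2 + -(67 * 63 * x * y) + 63 ^ 2 * y ^ 2 = f2 at *
  generalize 67 ^ 2 * x ^ 2 + -(67 * 166 * x * y) + 166 ^ 2 * y ^ 2 = f3 at *
  generalize 32 ^ 2 * x ^ 2 + -(32 * 135 * x * y) + 135 ^ 2 * y ^ 2 = f4 at *
  rcases h0 with rfl | ((rfl | rfl) | rfl) | rfl
  · have n1 : f1 ≠ 0 := d01 rfl
    have n2 : f2 ≠ 0 := d02 rfl
    have n3 : f3 ≠ 0 := d03 rfl
    have n4 : f4 ≠ 0 := d04 rfl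
    have hx0 : x = 0 := by
      by_contra hne
      simp [hne, n1, n2, n3, n4] at hx
    have hy0 : y = 0 := by
      by_contra hne
      simp [hne, n1, n2, n3, n4] at hy
    exact hxy ⟨hx0, hy0⟩
  · have n0 : f0 ≠ 0 := fun h => d01 h rfl
    have n2 : f2 ≠ 0 := d12 rfl
    have n3 : f3 ≠ 0 := d13 rfl
    have n4 : f4 ≠ 0 := d14 rfl
    refine lin (b := 1) (c := 1) one_ne_zero one_ne_zero ?_ ?_ <;> by_contra hne
    · have hne : 2 * x + -y ≠ 0 := fun h => hne (by linear_combination h)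
      simp [hne, n0, n2, n3, n4] at hx
    · have hne : -x + 2 * y ≠ 0 := fun h => hne (by linear_combination -h)
      simp [hne, n0, n2, n3, n4] at hy
  · have n0 : f0 ≠ 0 := fun h => d02 h rfl
    have n1 : f1 ≠ 0 := fun h => d12 h rfl
    have n3 : f3 ≠ 0 := d23 rfl
    have n4 : f4 ≠ 0 := d24 rfl
    refine lin (b := 67) (c := 63) (by norm_num) (by norm_num) ?_ ?_ <;> by_contra hne
    · have hne : 67 ^ 2 * (2 * x) + -(y * (67 * 63)) ≠ 0 :=
        fun h => hne (by linear_combination h / 67)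
      simp [hne, n0, n1, n3, n4] at hx
    · have hne : -(67 * 63 * x) + 63 ^ 2 * (2 * y) ≠ 0 :=
        fun h => hne (by linear_combination -h / 63)
      simp [hne, n0, n1, n3, n4] at hy
  · have n0 : f0 ≠ 0 := fun h => d03 h rfl
    have n1 : f1 ≠ 0 := fun h => d13 h rfl
    have n2 : f2 ≠ 0 := fun h => d23 h rfl
    have n4 : f4 ≠ 0 := d34 rfl
    refine lin (b := 67) (c := 166) (by norm_num) (by norm_num) ?_ ?_ <;> by_contra hne
    · have hne : 67 ^ 2 * (2 * x) + -(y * (67 * 166)) ≠ 0 :=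
        fun h => hne (by linear_combination h / 67)
      simp [hne, n0, n1, n2, n4] at hx
    · have hne : -(67 * 166 * x) + 166 ^ 2 * (2 * y) ≠ 0 :=
        fun h => hne (by linear_combination -h / 166)
      simp [hne, n0, n1, n2, n4] at hy
  · have n0 : f0 ≠ 0 := fun h => d04 h rfl
    have n1 : f1 ≠ 0 := fun h => d14 h rfl
    have n2 : f2 ≠ 0 := fun h => d24 h rfl
    have n3 : f3 ≠ 0 := fun h => d34 h rfl
    refine lin (b := 32) (c := 135) (by norm_num) (by norm_num) ?_ ?_ <;> by_contra hne
    · have hne : 32 ^ 2 * (2 * x) + -(y * (32 * 135)) ≠ 0 :=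
        fun h => hne (by linear_combination h / 32)
      simp [hne, n0, n1, n2, n3] at hx
    · have hne : -(32 * 135 * x) + 135 ^ 2 * (2 * y) ≠ 0 :=
        fun h => hne (by linear_combination -h / 135)
      simp [hne, n0, n1, n2, n3] at hy

/-- The cubic form `x³ + 11y³`. -/
def cubicForm (x y : ℤ) : ℤ := x ^ 3 + 11 * y ^ 3

/-- The norm form `b²x² - bcxy + c²y²`, a factor of `(bx)³ + (cy)³`. -/
def normForm (b c x y : ℤ) : ℤ := b ^ 2 * x ^ 2 - b * c * x * y + c ^ 2 * y ^ 2

lemma normForm_mul (b c x y : ℤ) :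
    normForm b c x y * (b * x + c * y) = b ^ 3 * x ^ 3 + c ^ 3 * y ^ 3 := by
  unfold normForm
  ring

lemma normForm_ne_zero {b c x y : ℤ} (hb : b ≠ 0) (hc : c ≠ 0) (hxy : IsCoprime x y) :
    normForm b c x y ≠ 0 := by
  intro h
  unfold normForm at h
  have hx : b * x = 0 := by nlinarith [sq_nonneg (b * x - 2 * (c * y)), sq_nonneg (b * x)]
  have hy : c * y = 0 := by nlinarith [sq_nonneg (2 * (b * x) - c * y), sq_nonneg (c * y)]
  have hx' := (mul_eq_zero.1 hx).resolve_left hb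
  have hy' := (mul_eq_zero.1 hy).resolve_left hc
  rw [hx', hy'] at hxy
  exact not_isCoprime_zero_zero hxy

lemma cubicForm_ne_zero {x y : ℤ} (hxy : IsCoprime x y) : cubicForm x y ≠ 0 := by
  intro h
  have key : ∀ a b : ZMod 7, a ^ 3 + 11 * b ^ 3 = 0 → a = 0 ∧ b = 0 := by decide
  have h7 := key x y (by exact_mod_cast congrArg (Int.cast : ℤ → ZMod 7) h)
  rw [ZMod.intCast_zmod_eq_zero_iff_dvd, ZMod.intCast_zmod_eq_zero_iff_dvd] at h7
  have := hxy.isUnit_of_dvd' h7.1 h7.2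
  norm_num [Int.isUnit_iff] at this

/-- Coprime `x`, `y` satisfying the equation together with `z`. -/
def IsPrimitiveSolution (x y z : ℤ) : Prop :=
  IsCoprime x y ∧ cubicForm x y * normForm 1 1 x y * normForm 67 63 x y *
    normForm 67 166 x y * normForm 32 135 x y = 1000121 ^ 6 * z ^ 11

lemma exists_primitive_solution {X Y Z : ℚ} (h0 : (X, Y, Z) ≠ (0, 0, 0))
    (h : EqnHolds 11 (1000121 ^ 6) 11 ![(1, -1), (67, -63), (-67, 166), (32, -135)] X Y Z) :
    ∃ x y z : ℤ, IsPrimitiveSolution x y z := by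
  rw [eqnHolds_iff] at h
  have hXY : ¬ (X = 0 ∧ Y = 0) := by
    rintro ⟨rfl, rfl⟩
    apply h0
    norm_num at h
    simp [h]
  obtain ⟨r, x, y, hr, hxy, rfl, rfl⟩ : ∃ (r : ℚ) (x y : ℤ), r ≠ 0 ∧ IsCoprime x y ∧
      X = r * x ∧ Y = r * y := by
    have hX : X = (X.num * Y.den : ℤ) / (X.den * Y.den : ℤ) := by
      push_cast
      rw [mul_div_mul_right _ _ (by exact_mod_cast Y.den_ne_zero), Rat.num_div_den]
    have hY : Y = (Y.num * X.den : ℤ) / (X.den * Y.den : ℤ) := by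
      push_cast
      rw [mul_comm, mul_div_mul_left _ _ (by exact_mod_cast X.den_ne_zero), Rat.num_div_den]
    have hd : ((X.den * Y.den : ℤ) : ℚ) ≠ 0 := by
      exact_mod_cast mul_ne_zero X.den_ne_zero Y.den_ne_zero
    set a : ℤ := X.num * Y.den
    set b : ℤ := Y.num * X.den
    set d : ℤ := X.den * Y.den
    have hab : a ≠ 0 ∨ b ≠ 0 := by
      by_contra! hab
      exact hXY ⟨by rw [hX, hab.1]; simp, by rw [hY, hab.2]; simp⟩
    have hg : 0 < Int.gcd a b := Int.gcd_pos_iff.2 hab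
    obtain ⟨x, y, hxy, ha, hb⟩ := Int.exists_gcd_one hg
    refine ⟨(Int.gcd a b : ℤ) / d, x, y, ?_, Int.isCoprime_iff_gcd_eq_one.2 hxy, ?_, ?_⟩
    · have : ((Int.gcd a b : ℤ) : ℚ) ≠ 0 := by exact_mod_cast hg.ne'
      exact div_ne_zero this hd
    · rw [hX, div_mul_eq_mul_div, ← Int.cast_mul, mul_comm (Int.gcd a b : ℤ), ← ha]
    · rw [hY, div_mul_eq_mul_div, ← Int.cast_mul, mul_comm (Int.gcd a b : ℤ), ← hb]
  set F : ℤ := cubicForm x y * normForm 1 1 x y * normForm 67 63 x y *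
    normForm 67 166 x y * normForm 32 135 x y with hF
  have hFq : (F : ℚ) = 1000121 ^ 6 * (Z / r) ^ 11 := by
    rw [div_pow, mul_div_assoc', eq_div_iff (pow_ne_zero _ hr), ← h, hF]
    unfold cubicForm normForm
    push_cast
    ring
  have hs : (1000121 * (Z / r)) ^ 11 = ((1000121 ^ 5 * F : ℤ) : ℚ) := by
    push_cast
    rw [hFq]
    ring
  obtain ⟨s, hs'⟩ : ∃ s : ℤ, (s : ℚ) = 1000121 * (Z / r) := by
    have hZ : IsIntegral ℤ (1000121 * (Z / r)) := by
      refine IsIntegral.of_pow (n := 11) (by norm_num) ?_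
      rw [hs]
      exact isIntegral_algebraMap
    exact IsIntegrallyClosed.isIntegral_iff.1 hZ
  rw [← hs'] at hs
  have hs2 : s ^ 11 = 1000121 ^ 5 * F := by exact_mod_cast hs
  have hp : Prime (1000121 : ℤ) := by
    have : Nat.Prime 1000121 := by norm_num
    exact_mod_cast Nat.prime_iff_prime_int.1 this
  obtain ⟨z, rfl⟩ : (1000121 : ℤ) ∣ s :=
    hp.dvd_of_dvd_pow (n := 11) (hs2 ▸ Dvd.dvd.mul_right (dvd_pow_self _ (by norm_num)) _)
  refine ⟨x, y, z, hxy, ?_⟩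
  refine mul_left_cancel₀ (pow_ne_zero 5 hp.ne_zero) ?_
  rw [← hs2]
  ring

lemma dvd_det_of_dvd {l β γ β' γ' x y : ℤ} (hxy : IsCoprime x y)
    (h : l ∣ β * x ^ 3 + γ * y ^ 3) (h' : l ∣ β' * x ^ 3 + γ' * y ^ 3) :
    l ∣ β * γ' - β' * γ := by
  obtain ⟨u, v, huv⟩ := hxy.pow (m := 3) (n := 3)
  have e : β * γ' - β' * γ = (β * x ^ 3 + γ * y ^ 3) * (u * γ' - v * β') +
      (β' * x ^ 3 + γ' * y ^ 3) * (v * β - u * γ) := by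
    linear_combination (-(β * γ' - β' * γ)) * huv
  rw [e]
  exact (h.mul_right _).add (h'.mul_right _)

section

variable {l : ℕ} [hl : Fact l.Prime] {x y : ℤ}

lemma padicValInt_ne_zero_iff {a : ℤ} (ha : a ≠ 0) : padicValInt l a ≠ 0 ↔ (l : ℤ) ∣ a := by
  have := padicValInt_dvd_iff (p := l) 1 a
  rw [pow_one] at this
  rw [this, Nat.one_le_iff_ne_zero]
  simp [ha]

lemma padicValInt_mul_of_not_dvd {a b : ℤ} (ha : a ≠ 0) (hb : ¬ (l : ℤ) ∣ b) :
    padicValInt l (a * b) = padicValInt l a := by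
  have hb0 : b ≠ 0 := by rintro rfl; simp at hb
  rw [padicValInt.mul ha hb0, not_not.1 (mt (padicValInt_ne_zero_iff hb0).1 hb), add_zero]

lemma min_padicValInt_le {a b c : ℤ} (hc : c ≠ 0)
    (h : (l : ℤ) ^ min (padicValInt l a) (padicValInt l b) ∣ a →
      (l : ℤ) ^ min (padicValInt l a) (padicValInt l b) ∣ b →
      (l : ℤ) ^ min (padicValInt l a) (padicValInt l b) ∣ c) :
    min (padicValInt l a) (padicValInt l b) ≤ padicValInt l c := by
  refine ((padicValInt_dvd_iff _ _).1 (h ?_ ?_)).resolve_left hc <;>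
  simp [padicValInt_dvd_iff]

/-- Two forms dividing the binary cubics `βx³ + γy³` and `β'x³ + γ'y³` have valuations at `l`
satisfying the ultrametric relations with the valuation `r` of the determinant. -/
lemma padicValInt_ultrametric {A B LA LB β γ β' γ' : ℤ} {r : ℕ}
    (hA : A * LA = β * x ^ 3 + γ * y ^ 3) (hB : B * LB = β' * x ^ 3 + γ' * y ^ 3)
    (hA0 : A ≠ 0) (hB0 : B ≠ 0) (hLA : ¬ (l : ℤ) ∣ LA) (hLB : ¬ (l : ℤ) ∣ LB)
    (hβ : ¬ (l : ℤ) ∣ β) (hβ' : ¬ (l : ℤ) ∣ β') (hy : ¬ (l : ℤ) ∣ y)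
    (hd0 : β * γ' - β' * γ ≠ 0) (hd : padicValInt l (β * γ' - β' * γ) = r) :
    min (padicValInt l A) (padicValInt l B) ≤ r ∧
      min (padicValInt l B) r ≤ padicValInt l A ∧
      min (padicValInt l A) r ≤ padicValInt l B := by
  have hp := Nat.prime_iff_prime_int.1 hl.out
  have ne {b : ℤ} (hb : ¬ (l : ℤ) ∣ b) : b ≠ 0 := by rintro rfl; simp at hb
  have vA : padicValInt l (A * (LA * β')) = padicValInt l A :=
    padicValInt_mul_of_not_dvd hA0 (by rw [hp.dvd_mul]; tauto)
  have vB : padicValInt l (B * (LB * β)) = padicValInt l B :=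
    padicValInt_mul_of_not_dvd hB0 (by rw [hp.dvd_mul]; tauto)
  have vC : padicValInt l ((β * γ' - β' * γ) * y ^ 3) = r := by
    rw [padicValInt_mul_of_not_dvd hd0 (fun h => hy (hp.dvd_of_dvd_pow h)), hd]
  have key : B * (LB * β) - A * (LA * β') = (β * γ' - β' * γ) * y ^ 3 := by
    linear_combination β * hB - β' * hA
  rw [← vA, ← vB, ← vC]
  refine ⟨min_padicValInt_le (mul_ne_zero hd0 (pow_ne_zero _ (ne hy))) fun h₁ h₂ => ?_,
    min_padicValInt_le (mul_ne_zero hA0 (mul_ne_zero (ne hLA) (ne hβ'))) fun h₁ h₂ => ?_,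
    min_padicValInt_le (mul_ne_zero hB0 (mul_ne_zero (ne hLB) (ne hβ))) fun h₁ h₂ => ?_⟩
  · rw [← key]; exact h₂.sub h₁
  · rw [show A * (LA * β') = B * (LB * β) - (β * γ' - β' * γ) * y ^ 3 by rw [← key]; ring]
    exact h₁.sub h₂
  · rw [show B * (LB * β) = A * (LA * β') + (β * γ' - β' * γ) * y ^ 3 by rw [← key]; ring]
    exact h₁.add h₂

lemma not_dvd_of_dvd_normForm {b c : ℤ} (hxy : IsCoprime x y) (hbc : ¬ (l : ℤ) ∣ 3 * b * c)
    (h : (l : ℤ) ∣ normForm b c x y) :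
    ¬ (l : ℤ) ∣ y ∧ ¬ (l : ℤ) ∣ b * x + c * y := by
  have hp := Nat.prime_iff_prime_int.1 hl.out
  have hb : ¬ (l : ℤ) ∣ b := fun h => hbc ((h.mul_left 3).mul_right c)
  have hc : ¬ (l : ℤ) ∣ c := fun h => hbc (h.mul_left _)
  have hxy' : ¬ ((l : ℤ) ∣ x ∧ (l : ℤ) ∣ y) := fun h' =>
    hp.not_isUnit (hxy.isUnit_of_dvd' h'.1 h'.2)
  have hyx : (l : ℤ) ∣ y → (l : ℤ) ∣ x := fun hy => by
    have h2 : (l : ℤ) ∣ b ^ 2 * x ^ 2 := by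
      rw [show b ^ 2 * x ^ 2 = normForm b c x y + y * (b * c * x - c ^ 2 * y) by
        unfold normForm; ring]
      exact h.add (hy.mul_right _)
    rw [← mul_pow] at h2
    exact (hp.dvd_or_dvd (hp.dvd_of_dvd_pow h2)).resolve_left hb
  have hxy2 : (l : ℤ) ∣ x → (l : ℤ) ∣ y := fun hx => by
    have h2 : (l : ℤ) ∣ c ^ 2 * y ^ 2 := by
      rw [show c ^ 2 * y ^ 2 = normForm b c x y + x * (b * c * y - b ^ 2 * x) by
        unfold normForm; ring]
      exact h.add (hx.mul_right _)
    rw [← mul_pow] at h2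
    exact (hp.dvd_or_dvd (hp.dvd_of_dvd_pow h2)).resolve_left hc
  refine ⟨fun hy => hxy' ⟨hyx hy, hy⟩, fun hL => ?_⟩
  have h2 : (l : ℤ) ∣ 3 * b * c * (x * y) := by
    rw [show 3 * b * c * (x * y) = (b * x + c * y) * (b * x + c * y) - normForm b c x y by
      unfold normForm; ring]
    exact (hL.mul_right _).sub h
  rcases hp.dvd_or_dvd ((hp.dvd_or_dvd h2).resolve_left hbc) with h3 | h3
  · exact hxy' ⟨h3, hxy2 h3⟩
  · exact hxy' ⟨hyx h3, h3⟩

/-- Primes `l ≡ 2 [MOD 3]` divide `u² - uv + v²` only if they divide `u` and `v`. -/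
lemma not_dvd_normForm {b c : ℤ} (hxy : IsCoprime x y) (hl3 : l % 3 = 2)
    (hbc : ¬ (l : ℤ) ∣ b * c) : ¬ (l : ℤ) ∣ normForm b c x y := by
  intro h
  have hp := Nat.prime_iff_prime_int.1 hl.out
  have h3 : ¬ (l : ℤ) ∣ 3 := fun h => by
    have : l = 3 := (Nat.prime_dvd_prime_iff_eq hl.out Nat.prime_three).1 (by exact_mod_cast h)
    omega
  have hbc' : ¬ (l : ℤ) ∣ 3 * b * c := by
    rw [mul_assoc, hp.dvd_mul]
    tauto
  apply (not_dvd_of_dvd_normForm hxy hbc' h).2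
  obtain ⟨k, hk⟩ : ∃ k, l + (l - 1) = 3 * (2 * k + 1) := ⟨l / 3, by omega⟩
  have cube (u : ZMod l) : u = (u ^ 3) ^ (2 * k + 1) := by
    rw [← pow_mul, ← hk, pow_add, ZMod.pow_card, ← pow_succ',
      Nat.sub_add_cancel hl.out.one_le, ZMod.pow_card]
  rw [← ZMod.intCast_zmod_eq_zero_iff_dvd] at h ⊢
  have h' := congrArg (Int.cast : ℤ → ZMod l) (normForm_mul b c x y)
  push_cast at h' ⊢
  rw [h, zero_mul] at h'
  have e : ((b : ZMod l) * x) ^ 3 = (-(c * y)) ^ 3 := by linear_combination -h'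
  rw [cube (b * x), e, ← cube]
  ring

/-- Valuations of two norm forms at a prime `l`. -/
lemma padicValInt_normForm_normForm {b c b' c' : ℤ} (r : ℕ) (hxy : IsCoprime x y)
    (h : ¬ (l : ℤ) ∣ 3 * b * c) (h' : ¬ (l : ℤ) ∣ 3 * b' * c')
    (hd0 : b ^ 3 * c' ^ 3 - b' ^ 3 * c ^ 3 ≠ 0)
    (hd : padicValInt l (b ^ 3 * c' ^ 3 - b' ^ 3 * c ^ 3) = r) :
    min (padicValInt l (normForm b c x y)) (padicValInt l (normForm b' c' x y)) = 0 ∨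
    (min (padicValInt l (normForm b c x y)) (padicValInt l (normForm b' c' x y)) ≤ r ∧
      min (padicValInt l (normForm b' c' x y)) r ≤ padicValInt l (normForm b c x y) ∧
      min (padicValInt l (normForm b c x y)) r ≤ padicValInt l (normForm b' c' x y)) := by
  have hp := Nat.prime_iff_prime_int.1 hl.out
  have split {b c : ℤ} (h : ¬ (l : ℤ) ∣ 3 * b * c) : b ≠ 0 ∧ c ≠ 0 ∧ ¬ (l : ℤ) ∣ b ^ 3 := by
    refine ⟨?_, ?_, fun hb => h (((hp.dvd_of_dvd_pow hb).mul_left 3).mul_right c)⟩ <;>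
    · rintro rfl
      simp at h
  obtain ⟨hb, hc, hlb⟩ := split h
  obtain ⟨hb', hc', hlb'⟩ := split h'
  have hA := normForm_ne_zero hb hc hxy
  have hB := normForm_ne_zero hb' hc' hxy
  refine or_iff_not_imp_left.2 fun hmin => ?_
  have hdA := (padicValInt_ne_zero_iff (l := l) hA).1 (by omega)
  have hdB := (padicValInt_ne_zero_iff (l := l) hB).1 (by omega)
  obtain ⟨hy, hLA⟩ := not_dvd_of_dvd_normForm hxy h hdA
  exact padicValInt_ultrametric (normForm_mul b c x y) (normForm_mul b' c' x y) hA hB hLA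
    (not_dvd_of_dvd_normForm hxy h' hdB).2 hlb hlb' hy hd0 hd

/-- Valuations of the cubic form and a norm form at a prime `l`. -/
lemma padicValInt_cubicForm_normForm {b c : ℤ} (r : ℕ) (hxy : IsCoprime x y)
    (h : ¬ (l : ℤ) ∣ 3 * b * c) (hd0 : 1 * c ^ 3 - b ^ 3 * 11 ≠ 0)
    (hd : padicValInt l (1 * c ^ 3 - b ^ 3 * 11) = r) :
    min (padicValInt l (cubicForm x y)) (padicValInt l (normForm b c x y)) = 0 ∨
    (min (padicValInt l (cubicForm x y)) (padicValInt l (normForm b c x y)) ≤ r ∧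
      min (padicValInt l (normForm b c x y)) r ≤ padicValInt l (cubicForm x y) ∧
      min (padicValInt l (cubicForm x y)) r ≤ padicValInt l (normForm b c x y)) := by
  have hp := Nat.prime_iff_prime_int.1 hl.out
  have hb : b ≠ 0 := by rintro rfl; simp at h
  have hc : c ≠ 0 := by rintro rfl; simp at h
  have hA := cubicForm_ne_zero hxy
  have hB := normForm_ne_zero hb hc hxy
  refine or_iff_not_imp_left.2 fun hmin => ?_
  have hdB := (padicValInt_ne_zero_iff (l := l) hB).1 (by omega)
  obtain ⟨hy, hLB⟩ := not_dvd_of_dvd_normForm hxy h hdB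
  exact padicValInt_ultrametric (LA := 1) (by unfold cubicForm; ring) (normForm_mul b c x y)
    hA hB hp.not_dvd_one hLB hp.not_dvd_one
    (fun hb => h (((hp.dvd_of_dvd_pow hb).mul_left 3).mul_right c)) hy hd0 hd

lemma dvd_of_padicValInt_normForm_normForm {b c b' c' : ℤ} (hxy : IsCoprime x y)
    (h : min (padicValInt l (normForm b c x y)) (padicValInt l (normForm b' c' x y)) ≠ 0) :
    (l : ℤ) ∣ b ^ 3 * c' ^ 3 - b' ^ 3 * c ^ 3 := by
  have hdvd {a : ℤ} (h : padicValInt l a ≠ 0) : (l : ℤ) ∣ a :=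
    (padicValInt_ne_zero_iff (by rintro rfl; simp at h)).1 h
  refine dvd_det_of_dvd hxy ?_ ?_ <;> rw [← normForm_mul] <;>
  exact (hdvd (by omega)).mul_right _

lemma dvd_of_padicValInt_cubicForm_normForm {b c : ℤ} (hxy : IsCoprime x y)
    (h : min (padicValInt l (cubicForm x y)) (padicValInt l (normForm b c x y)) ≠ 0) :
    (l : ℤ) ∣ 1 * c ^ 3 - b ^ 3 * 11 := by
  have hdvd {a : ℤ} (h : padicValInt l a ≠ 0) : (l : ℤ) ∣ a :=
    (padicValInt_ne_zero_iff (by rintro rfl; simp at h)).1 h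
  refine dvd_det_of_dvd hxy ?_ ?_
  · rw [one_mul]
    exact hdvd (a := cubicForm x y) (by omega)
  · rw [← normForm_mul]
    exact (hdvd (by omega)).mul_right _

end

section

variable {l : ℕ} [hl : Fact l.Prime] {x y z : ℤ}

lemma mem_of_prime_dvd {n : ℤ} (L : List ℕ) (hL : ∀ q ∈ L, q.Prime) (hn : n.natAbs = L.prod)
    (h : (l : ℤ) ∣ n) : l ∈ L := by
  rw [Int.natCast_dvd, hn] at h
  exact mem_list_primes_of_dvd_prod hl.out.prime (fun q hq => (hL q hq).prime) h

lemma padicValInt_normForm_eq_zero {b c : ℤ} (hxy : IsCoprime x y) (hl3 : l % 3 = 2)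
    (hbc : ¬ (l : ℤ) ∣ b * c) : padicValInt l (normForm b c x y) = 0 := by
  rw [padicValInt.eq_zero_iff]
  exact .inr (.inr (not_dvd_normForm hxy hl3 hbc))

lemma min_padicValInt_zero_one (hxy : IsCoprime x y) :
    min (padicValInt l (cubicForm x y)) (padicValInt l (normForm 1 1 x y)) = 0 := by
  by_contra h
  have := mem_of_prime_dvd [2, 5] (by norm_num) (by norm_num)
    (dvd_of_padicValInt_cubicForm_normForm hxy h)
  simp only [List.mem_cons, List.not_mem_nil, or_false] at this
  rcases this with rfl | rfl <;>
  exact h (by rw [padicValInt_normForm_eq_zero hxy (by norm_num) (by norm_num), min_zero])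

lemma min_padicValInt_zero_two (hxy : IsCoprime x y) (h37 : l ≠ 37) (h1117 : l ≠ 1117) :
    min (padicValInt l (cubicForm x y)) (padicValInt l (normForm 67 63 x y)) = 0 := by
  by_contra h
  have := mem_of_prime_dvd [2, 37, 37, 1117] (by norm_num) (by norm_num)
    (dvd_of_padicValInt_cubicForm_normForm hxy h)
  simp only [List.mem_cons, List.not_mem_nil, or_false, h37, h1117] at this
  subst this
  exact h (by rw [padicValInt_normForm_eq_zero hxy (by norm_num) (by norm_num), min_zero])

lemma min_padicValInt_zero_three (hxy : IsCoprime x y) :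
    min (padicValInt l (cubicForm x y)) (padicValInt l (normForm 67 166 x y)) = 0 := by
  by_contra h
  have := mem_of_prime_dvd [1265903] (by norm_num) (by norm_num)
    (dvd_of_padicValInt_cubicForm_normForm hxy h)
  simp only [List.mem_cons, List.not_mem_nil, or_false] at this
  subst this
  exact h (by rw [padicValInt_normForm_eq_zero hxy (by norm_num) (by norm_num), min_zero])

lemma min_padicValInt_zero_four (hxy : IsCoprime x y) :
    min (padicValInt l (cubicForm x y)) (padicValInt l (normForm 32 135 x y)) = 0 := by
  by_contra h
  have := mem_of_prime_dvd [2099927] (by norm_num) (by norm_num)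
    (dvd_of_padicValInt_cubicForm_normForm hxy h)
  simp only [List.mem_cons, List.not_mem_nil, or_false] at this
  subst this
  exact h (by rw [padicValInt_normForm_eq_zero hxy (by norm_num) (by norm_num), min_zero])

lemma min_padicValInt_one_two (hxy : IsCoprime x y) (h31 : l ≠ 31) (h409 : l ≠ 409) :
    min (padicValInt l (normForm 1 1 x y)) (padicValInt l (normForm 67 63 x y)) = 0 := by
  by_contra h
  have := mem_of_prime_dvd [2, 2, 31, 409] (by norm_num) (by norm_num)
    (dvd_of_padicValInt_normForm_normForm hxy h)
  simp only [List.mem_cons, List.not_mem_nil, or_false, h31, h409, or_self] at this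
  subst this
  exact h (by rw [padicValInt_normForm_eq_zero hxy (by norm_num) (by norm_num), zero_min])

lemma min_padicValInt_one_three (hxy : IsCoprime x y) (h3 : l ≠ 3) (h14389 : l ≠ 14389) :
    min (padicValInt l (normForm 1 1 x y)) (padicValInt l (normForm 67 166 x y)) = 0 := by
  by_contra h
  have := mem_of_prime_dvd [3, 3, 3, 11, 14389] (by norm_num) (by norm_num)
    (dvd_of_padicValInt_normForm_normForm hxy h)
  simp only [List.mem_cons, List.not_mem_nil, or_false, h3, h14389, false_or] at this
  subst this
  exact h (by rw [padicValInt_normForm_eq_zero hxy (by norm_num) (by norm_num), zero_min])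

lemma min_padicValInt_one_four (hxy : IsCoprime x y) (h7 : l ≠ 7) (h13 : l ≠ 13) (h37 : l ≠ 37)
    (h103 : l ≠ 103) :
    min (padicValInt l (normForm 1 1 x y)) (padicValInt l (normForm 32 135 x y)) = 0 := by
  by_contra h
  have := mem_of_prime_dvd [7, 7, 13, 37, 103] (by norm_num) (by norm_num)
    (dvd_of_padicValInt_normForm_normForm hxy h)
  simp [h7, h13, h37, h103] at this

lemma min_padicValInt_two_three (hxy : IsCoprime x y) (h67 : l ≠ 67) (h103 : l ≠ 103)
    (h41983 : l ≠ 41983) :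
    min (padicValInt l (normForm 67 63 x y)) (padicValInt l (normForm 67 166 x y)) = 0 := by
  by_contra h
  have := mem_of_prime_dvd [67, 67, 67, 103, 41983] (by norm_num) (by norm_num)
    (dvd_of_padicValInt_normForm_normForm hxy h)
  simp [h67, h103, h41983] at this

lemma min_padicValInt_two_four (hxy : IsCoprime x y) (h3 : l ≠ 3) (h571 : l ≠ 571)
    (h2251 : l ≠ 2251) :
    min (padicValInt l (normForm 67 63 x y)) (padicValInt l (normForm 32 135 x y)) = 0 := by
  by_contra h
  have := mem_of_prime_dvd [3, 3, 3, 3, 3, 3, 11, 71, 571, 2251] (by norm_num) (by norm_num)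
    (dvd_of_padicValInt_normForm_normForm hxy h)
  simp only [List.mem_cons, List.not_mem_nil, or_false, h3, h571, h2251, false_or] at this
  rcases this with rfl | rfl <;>
  exact h (by rw [padicValInt_normForm_eq_zero hxy (by norm_num) (by norm_num), zero_min])

lemma padicValInt_sum (hxy : IsCoprime x y)
    (h : cubicForm x y * normForm 1 1 x y * normForm 67 63 x y *
      normForm 67 166 x y * normForm 32 135 x y = 1000121 ^ 6 * z ^ 11) :
    padicValInt l (cubicForm x y) + padicValInt l (normForm 1 1 x y) +
      padicValInt l (normForm 67 63 x y) + padicValInt l (normForm 67 166 x y) +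
      padicValInt l (normForm 32 135 x y) = 6 * padicValInt l 1000121 + 11 * padicValInt l z := by
  have h0 := cubicForm_ne_zero hxy
  have h1 := normForm_ne_zero (b := 1) (c := 1) (by norm_num) (by norm_num) hxy
  have h2 := normForm_ne_zero (b := 67) (c := 63) (by norm_num) (by norm_num) hxy
  have h3 := normForm_ne_zero (b := 67) (c := 166) (by norm_num) (by norm_num) hxy
  have h4 := normForm_ne_zero (b := 32) (c := 135) (by norm_num) (by norm_num) hxy
  have hz : z ≠ 0 := by
    rintro rfl
    have := mul_ne_zero (mul_ne_zero (mul_ne_zero (mul_ne_zero h0 h1) h2) h3) h4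
    simp [h] at this
  have pow (a : ℤ) (n : ℕ) : padicValInt l (a ^ n) = n * padicValInt l a := by
    unfold padicValInt
    rw [Int.natAbs_pow, padicValNat.pow]
  have := congrArg (padicValInt l) h
  rwa [padicValInt.mul (by positivity) h4, padicValInt.mul (by positivity) h3,
    padicValInt.mul (by positivity) h2, padicValInt.mul h0 h1,
    padicValInt.mul (by norm_num) (pow_ne_zero _ hz), pow, pow] at this

lemma padicValInt_prime_of_ne {q : ℕ} (hq : q.Prime) (h : l ≠ q) : padicValInt l q = 0 := by
  rw [padicValInt.eq_zero_iff]
  refine .inr (.inr fun h' => h ?_)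
  exact (Nat.prime_dvd_prime_iff_eq hl.out hq).1 (by exact_mod_cast h')

end

section

variable {x y z : ℤ}

lemma padicValInt_eq_of_eq_pow_mul {l : ℕ} [hl : Fact l.Prime] {n : ℤ} (r : ℕ) (d : ℤ)
    (h : n = (l : ℤ) ^ r * d) (hd : ¬ (l : ℤ) ∣ d) : padicValInt l n = r := by
  have hl0 : (l : ℤ) ≠ 0 := by exact_mod_cast hl.out.ne_zero
  rw [h, padicValInt_mul_of_not_dvd (pow_ne_zero _ hl0) hd]
  unfold padicValInt
  rw [Int.natAbs_pow, Int.natAbs_natCast, padicValNat.prime_pow]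

lemma padicValInt_pow_mul {l : ℕ} [hl : Fact l.Prime] {a : ℤ} (r : ℕ) (ha : a ≠ 0) :
    padicValInt l ((l : ℤ) ^ r * a) = r + padicValInt l a := by
  have hl0 : (l : ℤ) ≠ 0 := by exact_mod_cast hl.out.ne_zero
  rw [padicValInt.mul (pow_ne_zero _ hl0) ha,
    padicValInt_eq_of_eq_pow_mul r 1 (mul_one _).symm
      (Nat.prime_iff_prime_int.1 hl.out).not_dvd_one]

/-- The relations between the valuations of the five forms at a prime `l ≠ 1000121`. -/
lemma padicValInt_relations {l : ℕ} [Fact l.Prime] (hl : l ≠ 1000121)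
    (h : IsPrimitiveSolution x y z) :
    (padicValInt l (cubicForm x y) + padicValInt l (normForm 1 1 x y) +
      padicValInt l (normForm 67 63 x y) + padicValInt l (normForm 67 166 x y) +
      padicValInt l (normForm 32 135 x y)) % 11 = 0 ∧
    min (padicValInt l (cubicForm x y)) (padicValInt l (normForm 1 1 x y)) = 0 ∧
    (l ≠ 37 ∧ l ≠ 1117 →
      min (padicValInt l (cubicForm x y)) (padicValInt l (normForm 67 63 x y)) = 0) ∧
    min (padicValInt l (cubicForm x y)) (padicValInt l (normForm 67 166 x y)) = 0 ∧
    min (padicValInt l (cubicForm x y)) (padicValInt l (normForm 32 135 x y)) = 0 ∧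
    (l ≠ 31 ∧ l ≠ 409 →
      min (padicValInt l (normForm 1 1 x y)) (padicValInt l (normForm 67 63 x y)) = 0) ∧
    (l ≠ 3 ∧ l ≠ 14389 →
      min (padicValInt l (normForm 1 1 x y)) (padicValInt l (normForm 67 166 x y)) = 0) ∧
    (l ≠ 7 ∧ l ≠ 13 ∧ l ≠ 37 ∧ l ≠ 103 →
      min (padicValInt l (normForm 1 1 x y)) (padicValInt l (normForm 32 135 x y)) = 0) ∧
    (l ≠ 67 ∧ l ≠ 103 ∧ l ≠ 41983 →
      min (padicValInt l (normForm 67 63 x y)) (padicValInt l (normForm 67 166 x y)) = 0) ∧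
    (l ≠ 3 ∧ l ≠ 571 ∧ l ≠ 2251 →
      min (padicValInt l (normForm 67 63 x y)) (padicValInt l (normForm 32 135 x y)) = 0) := by
  obtain ⟨hxy, h⟩ := h
  refine ⟨?_, min_padicValInt_zero_one hxy, fun h => min_padicValInt_zero_two hxy h.1 h.2,
    min_padicValInt_zero_three hxy, min_padicValInt_zero_four hxy,
    fun h => min_padicValInt_one_two hxy h.1 h.2, fun h => min_padicValInt_one_three hxy h.1 h.2,
    fun h => min_padicValInt_one_four hxy h.1 h.2.1 h.2.2.1 h.2.2.2,
    fun h => min_padicValInt_two_three hxy h.1 h.2.1 h.2.2,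
    fun h => min_padicValInt_two_four hxy h.1 h.2.1 h.2.2⟩
  have hp := padicValInt_prime_of_ne (q := 1000121) (by norm_num) hl
  rw [padicValInt_sum hxy h, show (1000121 : ℤ) = (1000121 : ℕ) from rfl, hp]
  omega

lemma mod_eleven_of_ultrametric {u v r : ℕ} (hs : u = 0 ∨ (u + v) % 11 = 0)
    (h : min u v = 0 ∨ (min u v ≤ r ∧ min v r ≤ u ∧ min u r ≤ v)) :
    u % 11 = 0 ∨ u % 11 = r % 11 ∨ u % 11 = (10 * r) % 11 := by
  omega

lemma padicValInt_31 (h : IsPrimitiveSolution x y z) :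
    (padicValInt 31 (normForm 1 1 x y) % 11 = 0 ∨ padicValInt 31 (normForm 1 1 x y) % 11 = 1 ∨
      padicValInt 31 (normForm 1 1 x y) % 11 = 10) ∧
    (padicValInt 31 (normForm 1 1 x y) +
      padicValInt 31 (normForm 67 63 x y)) % 11 = 0 := by
  have : Fact (Nat.Prime 31) := ⟨by norm_num⟩
  have hrel := padicValInt_relations (l := 31) (by norm_num) h
  have hs : (padicValInt 31 (normForm 1 1 x y) + padicValInt 31 (normForm 67 63 x y)) % 11 = 0 := by
    omega
  have ho := mod_eleven_of_ultrametric (.inr hs)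
    (padicValInt_normForm_normForm (l := 31) (b := 1) (c := 1) (b' := 67) (c' := 63)
      1 h.1 (by norm_num) (by norm_num) (by norm_num)
      (padicValInt_eq_of_eq_pow_mul 1 ((1 ^ 3 * 63 ^ 3 - 67 ^ 3 * 1 ^ 3) / 31 ^ 1) (by norm_num)
        (by norm_num)))
  exact ⟨ho, hs⟩

lemma padicValInt_409 (h : IsPrimitiveSolution x y z) :
    (padicValInt 409 (normForm 1 1 x y) % 11 = 0 ∨ padicValInt 409 (normForm 1 1 x y) % 11 = 1 ∨
      padicValInt 409 (normForm 1 1 x y) % 11 = 10) ∧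
    (padicValInt 409 (normForm 1 1 x y) +
      padicValInt 409 (normForm 67 63 x y)) % 11 = 0 := by
  have : Fact (Nat.Prime 409) := ⟨by norm_num⟩
  have hrel := padicValInt_relations (l := 409) (by norm_num) h
  have hs : (padicValInt 409 (normForm 1 1 x y) +
    padicValInt 409 (normForm 67 63 x y)) % 11 = 0 := by
    omega
  have ho := mod_eleven_of_ultrametric (.inr hs)
    (padicValInt_normForm_normForm (l := 409) (b := 1) (c := 1) (b' := 67) (c' := 63)
      1 h.1 (by norm_num) (by norm_num) (by norm_num)
      (padicValInt_eq_of_eq_pow_mul 1 ((1 ^ 3 * 63 ^ 3 - 67 ^ 3 * 1 ^ 3) / 409 ^ 1) (by norm_num)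
        (by norm_num)))
  exact ⟨ho, hs⟩

lemma padicValInt_37 (h : IsPrimitiveSolution x y z) :
    (padicValInt 37 (cubicForm x y) % 11 = 0 ∨ padicValInt 37 (cubicForm x y) % 11 = 2 ∨
      padicValInt 37 (cubicForm x y) % 11 = 9) ∧
    (padicValInt 37 (cubicForm x y) +
      padicValInt 37 (normForm 67 63 x y)) % 11 = 0 ∧
    (padicValInt 37 (normForm 1 1 x y) % 11 = 0 ∨ padicValInt 37 (normForm 1 1 x y) % 11 = 1 ∨
      padicValInt 37 (normForm 1 1 x y) % 11 = 10) := by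
  have : Fact (Nat.Prime 37) := ⟨by norm_num⟩
  have hrel := padicValInt_relations (l := 37) (by norm_num) h
  have hs₁ : (padicValInt 37 (cubicForm x y) + padicValInt 37 (normForm 67 63 x y)) % 11 = 0 := by
    omega
  have ho₁ := mod_eleven_of_ultrametric (.inr hs₁)
    (padicValInt_cubicForm_normForm (l := 37) (b := 67) (c := 63) 2 h.1
      (by norm_num) (by norm_num)
      (padicValInt_eq_of_eq_pow_mul 2 ((1 * 63 ^ 3 - 67 ^ 3 * 11) / 37 ^ 2) (by norm_num)
        (by norm_num)))
  have hs₂ : padicValInt 37 (normForm 1 1 x y) = 0 ∨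
      (padicValInt 37 (normForm 1 1 x y) + padicValInt 37 (normForm 32 135 x y)) % 11 = 0 := by
    omega
  have ho₂ := mod_eleven_of_ultrametric hs₂
    (padicValInt_normForm_normForm (l := 37) (b := 1) (c := 1) (b' := 32) (c' := 135)
      1 h.1 (by norm_num) (by norm_num) (by norm_num)
      (padicValInt_eq_of_eq_pow_mul 1 ((1 ^ 3 * 135 ^ 3 - 32 ^ 3 * 1 ^ 3) / 37 ^ 1) (by norm_num)
        (by norm_num)))
  exact ⟨ho₁, hs₁, ho₂⟩

lemma padicValInt_1117 (h : IsPrimitiveSolution x y z) :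
    (padicValInt 1117 (cubicForm x y) % 11 = 0 ∨ padicValInt 1117 (cubicForm x y) % 11 = 1 ∨
      padicValInt 1117 (cubicForm x y) % 11 = 10) ∧
    (padicValInt 1117 (cubicForm x y) +
      padicValInt 1117 (normForm 67 63 x y)) % 11 = 0 := by
  have : Fact (Nat.Prime 1117) := ⟨by norm_num⟩
  have hrel := padicValInt_relations (l := 1117) (by norm_num) h
  have hs : (padicValInt 1117 (cubicForm x y) +
    padicValInt 1117 (normForm 67 63 x y)) % 11 = 0 := by
    omega
  have ho := mod_eleven_of_ultrametric (.inr hs)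
    (padicValInt_cubicForm_normForm (l := 1117) (b := 67) (c := 63) 1 h.1
      (by norm_num) (by norm_num)
      (padicValInt_eq_of_eq_pow_mul 1 ((1 * 63 ^ 3 - 67 ^ 3 * 11) / 1117 ^ 1) (by norm_num)
        (by norm_num)))
  exact ⟨ho, hs⟩

lemma padicValInt_14389 (h : IsPrimitiveSolution x y z) :
    (padicValInt 14389 (normForm 1 1 x y) % 11 = 0 ∨ padicValInt 14389 (normForm 1 1 x y) % 11 = 1 ∨
      padicValInt 14389 (normForm 1 1 x y) % 11 = 10) := by
  have : Fact (Nat.Prime 14389) := ⟨by norm_num⟩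
  have hrel := padicValInt_relations (l := 14389) (by norm_num) h
  have hs : padicValInt 14389 (normForm 1 1 x y) = 0 ∨
      (padicValInt 14389 (normForm 1 1 x y) +
        padicValInt 14389 (normForm 67 166 x y)) % 11 = 0 := by
    omega
  have ho := mod_eleven_of_ultrametric hs
    (padicValInt_normForm_normForm (l := 14389) (b := 1) (c := 1) (b' := 67) (c' := 166)
      1 h.1 (by norm_num) (by norm_num) (by norm_num)
      (padicValInt_eq_of_eq_pow_mul 1 ((1 ^ 3 * 166 ^ 3 - 67 ^ 3 * 1 ^ 3) / 14389 ^ 1) (by norm_num)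
        (by norm_num)))
  exact ho

lemma padicValInt_103 (h : IsPrimitiveSolution x y z) :
    (padicValInt 103 (normForm 1 1 x y) % 11 = 0 ∨ padicValInt 103 (normForm 1 1 x y) % 11 = 1 ∨
      padicValInt 103 (normForm 1 1 x y) % 11 = 10) ∧
    (padicValInt 103 (normForm 67 63 x y) % 11 = 0 ∨ padicValInt 103 (normForm 67 63 x y) % 11 = 1 ∨
      padicValInt 103 (normForm 67 63 x y) % 11 = 10) := by
  have : Fact (Nat.Prime 103) := ⟨by norm_num⟩
  have hrel := padicValInt_relations (l := 103) (by norm_num) h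
  have hs₁ : padicValInt 103 (normForm 1 1 x y) = 0 ∨
      (padicValInt 103 (normForm 1 1 x y) + padicValInt 103 (normForm 32 135 x y)) % 11 = 0 := by
    omega
  have ho₁ := mod_eleven_of_ultrametric hs₁
    (padicValInt_normForm_normForm (l := 103) (b := 1) (c := 1) (b' := 32) (c' := 135)
      1 h.1 (by norm_num) (by norm_num) (by norm_num)
      (padicValInt_eq_of_eq_pow_mul 1 ((1 ^ 3 * 135 ^ 3 - 32 ^ 3 * 1 ^ 3) / 103 ^ 1) (by norm_num)
        (by norm_num)))
  have hs₂ : padicValInt 103 (normForm 67 63 x y) = 0 ∨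
      (padicValInt 103 (normForm 67 63 x y) + padicValInt 103 (normForm 67 166 x y)) % 11 = 0 := by
    omega
  have ho₂ := mod_eleven_of_ultrametric hs₂
    (padicValInt_normForm_normForm (l := 103) (b := 67) (c := 63) (b' := 67) (c' := 166)
      1 h.1 (by norm_num) (by norm_num) (by norm_num)
      (padicValInt_eq_of_eq_pow_mul 1 ((67 ^ 3 * 166 ^ 3 - 67 ^ 3 * 63 ^ 3) / 103 ^ 1) (by norm_num)
        (by norm_num)))
  exact ⟨ho₁, ho₂⟩

lemma padicValInt_7 (h : IsPrimitiveSolution x y z) :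
    (padicValInt 7 (normForm 1 1 x y) % 11 = 0 ∨ padicValInt 7 (normForm 1 1 x y) % 11 = 2 ∨
      padicValInt 7 (normForm 1 1 x y) % 11 = 9) := by
  have : Fact (Nat.Prime 7) := ⟨by norm_num⟩
  have hrel := padicValInt_relations (l := 7) (by norm_num) h
  have hs : padicValInt 7 (normForm 1 1 x y) = 0 ∨
      (padicValInt 7 (normForm 1 1 x y) + padicValInt 7 (normForm 32 135 x y)) % 11 = 0 := by
    omega
  have ho := mod_eleven_of_ultrametric hs
    (padicValInt_normForm_normForm (l := 7) (b := 1) (c := 1) (b' := 32) (c' := 135)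
      2 h.1 (by norm_num) (by norm_num) (by norm_num)
      (padicValInt_eq_of_eq_pow_mul 2 ((1 ^ 3 * 135 ^ 3 - 32 ^ 3 * 1 ^ 3) / 7 ^ 2) (by norm_num)
        (by norm_num)))
  exact ho

lemma padicValInt_13 (h : IsPrimitiveSolution x y z) :
    (padicValInt 13 (normForm 1 1 x y) % 11 = 0 ∨ padicValInt 13 (normForm 1 1 x y) % 11 = 1 ∨
      padicValInt 13 (normForm 1 1 x y) % 11 = 10) := by
  have : Fact (Nat.Prime 13) := ⟨by norm_num⟩
  have hrel := padicValInt_relations (l := 13) (by norm_num) h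
  have hs : padicValInt 13 (normForm 1 1 x y) = 0 ∨
      (padicValInt 13 (normForm 1 1 x y) + padicValInt 13 (normForm 32 135 x y)) % 11 = 0 := by
    omega
  have ho := mod_eleven_of_ultrametric hs
    (padicValInt_normForm_normForm (l := 13) (b := 1) (c := 1) (b' := 32) (c' := 135)
      1 h.1 (by norm_num) (by norm_num) (by norm_num)
      (padicValInt_eq_of_eq_pow_mul 1 ((1 ^ 3 * 135 ^ 3 - 32 ^ 3 * 1 ^ 3) / 13 ^ 1) (by norm_num)
        (by norm_num)))
  exact ho

lemma padicValInt_41983 (h : IsPrimitiveSolution x y z) :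
    (padicValInt 41983 (normForm 67 63 x y) % 11 = 0 ∨
      padicValInt 41983 (normForm 67 63 x y) % 11 = 1 ∨
      padicValInt 41983 (normForm 67 63 x y) % 11 = 10) := by
  have : Fact (Nat.Prime 41983) := ⟨by norm_num⟩
  have hrel := padicValInt_relations (l := 41983) (by norm_num) h
  have hs : padicValInt 41983 (normForm 67 63 x y) = 0 ∨
      (padicValInt 41983 (normForm 67 63 x y) +
        padicValInt 41983 (normForm 67 166 x y)) % 11 = 0 := by
    omega
  have ho := mod_eleven_of_ultrametric hs
    (padicValInt_normForm_normForm (l := 41983) (b := 67) (c := 63) (b' := 67) (c' := 166)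
      1 h.1 (by norm_num) (by norm_num) (by norm_num)
      (padicValInt_eq_of_eq_pow_mul 1 ((67 ^ 3 * 166 ^ 3 - 67 ^ 3 * 63 ^ 3) / 41983 ^ 1) (by norm_num)
        (by norm_num)))
  exact ho

lemma padicValInt_571 (h : IsPrimitiveSolution x y z) :
    (padicValInt 571 (normForm 67 63 x y) % 11 = 0 ∨ padicValInt 571 (normForm 67 63 x y) % 11 = 1 ∨
      padicValInt 571 (normForm 67 63 x y) % 11 = 10) := by
  have : Fact (Nat.Prime 571) := ⟨by norm_num⟩
  have hrel := padicValInt_relations (l := 571) (by norm_num) h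
  have hs : padicValInt 571 (normForm 67 63 x y) = 0 ∨
      (padicValInt 571 (normForm 67 63 x y) + padicValInt 571 (normForm 32 135 x y)) % 11 = 0 := by
    omega
  have ho := mod_eleven_of_ultrametric hs
    (padicValInt_normForm_normForm (l := 571) (b := 67) (c := 63) (b' := 32) (c' := 135)
      1 h.1 (by norm_num) (by norm_num) (by norm_num)
      (padicValInt_eq_of_eq_pow_mul 1 ((67 ^ 3 * 135 ^ 3 - 32 ^ 3 * 63 ^ 3) / 571 ^ 1) (by norm_num)
        (by norm_num)))
  exact ho

lemma padicValInt_2251 (h : IsPrimitiveSolution x y z) :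
    (padicValInt 2251 (normForm 67 63 x y) % 11 = 0 ∨
      padicValInt 2251 (normForm 67 63 x y) % 11 = 1 ∨
      padicValInt 2251 (normForm 67 63 x y) % 11 = 10) := by
  have : Fact (Nat.Prime 2251) := ⟨by norm_num⟩
  have hrel := padicValInt_relations (l := 2251) (by norm_num) h
  have hs : padicValInt 2251 (normForm 67 63 x y) = 0 ∨
      (padicValInt 2251 (normForm 67 63 x y) +
        padicValInt 2251 (normForm 32 135 x y)) % 11 = 0 := by
    omega
  have ho := mod_eleven_of_ultrametric hs
    (padicValInt_normForm_normForm (l := 2251) (b := 67) (c := 63) (b' := 32) (c' := 135)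
      1 h.1 (by norm_num) (by norm_num) (by norm_num)
      (padicValInt_eq_of_eq_pow_mul 1 ((67 ^ 3 * 135 ^ 3 - 32 ^ 3 * 63 ^ 3) / 2251 ^ 1) (by norm_num)
        (by norm_num)))
  exact ho

lemma padicValInt_67 (h : IsPrimitiveSolution x y z) :
    (padicValInt 67 (normForm 67 63 x y) % 11 = 0 ∨ padicValInt 67 (normForm 67 63 x y) % 11 = 2 ∨
      padicValInt 67 (normForm 67 63 x y) % 11 = 9) := by
  have : Fact (Nat.Prime 67) := ⟨by norm_num⟩
  have := padicValInt_relations (l := 67) (by norm_num) h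
  have hp : Prime (67 : ℤ) := Nat.prime_iff_prime_int.1 (by norm_num : Nat.Prime 67)
  by_cases hy : (67 : ℤ) ∣ y
  · obtain ⟨y, rfl⟩ := hy
    have hxy' : IsCoprime x y := h.1.of_mul_right_right
    have e2 : normForm 67 63 x (67 * y) = ((67 : ℕ) : ℤ) ^ 2 * normForm 1 63 x y := by
      unfold normForm
      push_cast
      ring
    have e3 : normForm 67 166 x (67 * y) = ((67 : ℕ) : ℤ) ^ 2 * normForm 1 166 x y := by
      unfold normForm
      push_cast
      ring
    have v2 : padicValInt 67 (normForm 67 63 x (67 * y)) =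
        2 + padicValInt 67 (normForm 1 63 x y) := by
      rw [e2, padicValInt_pow_mul 2 (normForm_ne_zero (by norm_num) (by norm_num) hxy')]
    have v3 : padicValInt 67 (normForm 67 166 x (67 * y)) =
        2 + padicValInt 67 (normForm 1 166 x y) := by
      rw [e3, padicValInt_pow_mul 2 (normForm_ne_zero (by norm_num) (by norm_num) hxy')]
    have := padicValInt_normForm_normForm (l := 67) (b := 1) (c := 63) (b' := 1) (c' := 166)
      0 hxy' (by norm_num) (by norm_num) (by norm_num)
      (padicValInt_eq_of_eq_pow_mul 0 (1 ^ 3 * 166 ^ 3 - 1 ^ 3 * 63 ^ 3) (by norm_num)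
        (by norm_num))
    omega
  · have : padicValInt 67 (normForm 67 63 x y) = 0 := by
      rw [padicValInt.eq_zero_iff]
      refine .inr (.inr fun hd => hy ?_)
      have : (67 : ℤ) ∣ 63 ^ 2 * y ^ 2 := by
        rw [show 63 ^ 2 * y ^ 2 = normForm 67 63 x y - 67 * (67 * x ^ 2 - 63 * x * y) by
          unfold normForm; ring]
        exact dvd_sub hd (dvd_mul_right _ _)
      exact hp.dvd_of_dvd_pow ((hp.dvd_or_dvd this).resolve_left (by norm_num))
    omega

lemma not_three_dvd_both (hxy : IsCoprime x y) : ¬ ((3 : ℤ) ∣ x ∧ (3 : ℤ) ∣ y) := fun h => by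
  have := hxy.isUnit_of_dvd' h.1 h.2
  norm_num [Int.isUnit_iff] at this

lemma padicValInt_three_normForm_one_one (h : IsPrimitiveSolution x y z) :
    padicValInt 3 (normForm 1 1 x y) = 0 := by
  have : Fact (Nat.Prime 3) := ⟨Nat.prime_three⟩
  have h3 := not_three_dvd_both h.1
  have hrel := padicValInt_relations (l := 3) (by norm_num) h
  by_contra h0
  have h1 := (padicValInt_ne_zero_iff (l := 3)
    (normForm_ne_zero (by norm_num) (by norm_num) h.1)).1 h0
  push_cast at h1
  obtain ⟨k, hk⟩ : (3 : ℤ) ∣ x + y := by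
    refine Int.prime_three.dvd_of_dvd_pow (n := 2) ?_
    rw [show (x + y) ^ 2 = normForm 1 1 x y + 3 * (x * y) by unfold normForm; ring]
    exact h1.add (dvd_mul_right _ _)
  obtain rfl : y = 3 * k - x := by linear_combination hk
  have hx : ¬ (3 : ℤ) ∣ x := fun hx => h3 ⟨hx, (dvd_mul_right _ _).sub hx⟩
  have hx2 : ¬ (3 : ℤ) ∣ x ^ 2 := fun h => hx (Int.prime_three.dvd_of_dvd_pow h)
  have v1 := padicValInt_eq_of_eq_pow_mul (l := 3) 1 (x ^ 2 - 3 * (k * x) + 3 * k ^ 2)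
    (show normForm 1 1 x (3 * k - x) = _ by unfold normForm; push_cast; ring)
    (by push_cast; omega)
  have v3 := padicValInt_eq_of_eq_pow_mul (l := 3) 1
    (14389 * x ^ 2 - 66234 * (k * x) + 82668 * k ^ 2)
    (show normForm 67 166 x (3 * k - x) = _ by unfold normForm; push_cast; ring)
    (by push_cast; omega)
  have v4 : padicValInt 3 (normForm 32 135 x (3 * k - x)) = 0 := by
    rw [padicValInt.eq_zero_iff]
    refine .inr (.inr ?_)
    rw [show normForm 32 135 x (3 * k - x) =
      x ^ 2 + 3 * (7856 * x ^ 2 - 40770 * (k * x) + 54675 * k ^ 2) by unfold normForm; ring]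
    push_cast
    omega
  omega

/-- At `3` the form `normForm 67 63` has valuation `0` or `4` modulo `11`. -/
lemma padicValInt_three_normForm (h : IsPrimitiveSolution x y z) :
    padicValInt 3 (normForm 67 63 x y) % 11 = 0 ∨ padicValInt 3 (normForm 67 63 x y) % 11 = 4 := by
  have : Fact (Nat.Prime 3) := ⟨Nat.prime_three⟩
  have h3 := not_three_dvd_both h.1
  have hrel := padicValInt_relations (l := 3) (by norm_num) h
  have v1 := padicValInt_three_normForm_one_one h
  have sq {t : ℤ} (ht : ¬ (3 : ℤ) ∣ t) : ¬ (3 : ℤ) ∣ t ^ 2 :=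
    fun h => ht (Int.prime_three.dvd_of_dvd_pow h)
  by_cases hx : (3 : ℤ) ∣ x
  swap
  · left
    have : padicValInt 3 (normForm 67 63 x y) = 0 := by
      rw [padicValInt.eq_zero_iff]
      refine .inr (.inr ?_)
      have := sq hx
      rw [show normForm 67 63 x y = x ^ 2 + 3 * (1496 * x ^ 2 - 1407 * (x * y) + 1323 * y ^ 2) by
        unfold normForm; ring]
      push_cast
      omega
    omega
  have hy : ¬ (3 : ℤ) ∣ y := fun hy => h3 ⟨hx, hy⟩
  have hy2 := sq hy
  have hy3 : ¬ (3 : ℤ) ∣ y ^ 3 := fun h => hy (Int.prime_three.dvd_of_dvd_pow h)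
  obtain ⟨t, rfl⟩ := hx
  have v0 : padicValInt 3 (cubicForm (3 * t) y) = 0 := by
    rw [padicValInt.eq_zero_iff]
    refine .inr (.inr ?_)
    rw [show cubicForm (3 * t) y = 3 * (9 * t ^ 3) + 11 * y ^ 3 by unfold cubicForm; ring]
    push_cast
    omega
  have v3 : padicValInt 3 (normForm 67 166 (3 * t) y) = 0 := by
    rw [padicValInt.eq_zero_iff]
    refine .inr (.inr ?_)
    rw [show normForm 67 166 (3 * t) y = 3 * (13467 * t ^ 2 - 11122 * (t * y)) + 27556 * y ^ 2 by
      unfold normForm; ring]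
    push_cast
    omega
  by_cases ht : (3 : ℤ) ∣ t
  swap
  · have ht2 := sq ht
    have v2 := padicValInt_eq_of_eq_pow_mul (l := 3) 2
      (4489 * t ^ 2 + 3 * (147 * y ^ 2 - 469 * (t * y)))
      (show normForm 67 63 (3 * t) y = _ by unfold normForm; push_cast; ring)
      (by push_cast; omega)
    have v4 := padicValInt_eq_of_eq_pow_mul (l := 3) 2
      (1024 * t ^ 2 + 3 * (675 * y ^ 2 - 480 * (t * y)))
      (show normForm 32 135 (3 * t) y = _ by unfold normForm; push_cast; ring)
      (by push_cast; omega)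
    omega
  obtain ⟨t, rfl⟩ := ht
  have e2 : normForm 67 63 (3 * (3 * t)) y =
      ((3 : ℕ) : ℤ) ^ 4 * (4489 * t ^ 2 - 469 * (t * y) + 49 * y ^ 2) := by
    unfold normForm
    push_cast
    ring
  by_cases ht : (3 : ℤ) ∣ t
  · right
    obtain ⟨t, rfl⟩ := ht
    rw [show 4489 * (3 * t) ^ 2 - 469 * (3 * t * y) + 49 * y ^ 2 =
      3 * (13467 * t ^ 2 - 469 * (t * y)) + 49 * y ^ 2 by ring] at e2
    rw [padicValInt_eq_of_eq_pow_mul 4 _ e2 (by push_cast; omega)]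
  · have ht2 := sq ht
    have v4 := padicValInt_eq_of_eq_pow_mul (l := 3) 4
      (1024 * t ^ 2 + 3 * (75 * y ^ 2 - 160 * (t * y)))
      (show normForm 32 135 (3 * (3 * t)) y = _ by unfold normForm; push_cast; ring)
      (by push_cast; omega)
    have hdvd : ¬ (9 : ℤ) ∣ 4489 * t ^ 2 - 469 * (t * y) + 49 * y ^ 2 := fun h9 => by
      have key : ∀ a b : ZMod 9, 4489 * a ^ 2 - 469 * (a * b) + 49 * b ^ 2 = 0 → 3 * a = 0 := by
        decide
      have := key t y (by exact_mod_cast (ZMod.intCast_zmod_eq_zero_iff_dvd _ 9).2 h9)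
      have := (ZMod.intCast_zmod_eq_zero_iff_dvd (3 * t) 9).1 (by exact_mod_cast this)
      push_cast at this
      omega
    have hne : 4489 * t ^ 2 - 469 * (t * y) + 49 * y ^ 2 ≠ 0 := fun h0 => by simp [h0] at hdvd
    have := mt (padicValInt_dvd_iff (p := 3) 2 _).2 (by
      push_cast
      exact hdvd)
    have v2 := padicValInt_pow_mul (l := 3) 4 hne
    rw [← e2] at v2
    omega

end

/-- The integer `∏ l ^ e` described by a list of pairs `(l, e)`. -/
def powProd (L : List (ℕ × ℕ)) : ℤ := (L.map fun a => (a.1 : ℤ) ^ a.2).prod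

lemma exists_eq_pow_of_dvd_padicValInt {n : ℤ} (hn : n ≠ 0) {k : ℕ} (hk : Odd k)
    (h : ∀ l : ℕ, l.Prime → k ∣ padicValInt l n) : ∃ w : ℤ, n = w ^ k := by
  have hk0 : k ≠ 0 := hk.pos.ne'
  have key : n.natAbs = Nat.floorRoot k n.natAbs ^ k := by
    refine Nat.eq_of_factorization_eq (Int.natAbs_ne_zero.2 hn)
      (pow_ne_zero _ (Nat.floorRoot_ne_zero.2 ⟨hk0, Int.natAbs_ne_zero.2 hn⟩)) fun l => ?_
    rw [Nat.factorization_pow, Nat.factorization_floorRoot]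
    by_cases hl : l.Prime
    · have := h l hl
      rw [padicValInt, ← Nat.factorization_def _ hl] at this
      simp [Nat.mul_div_cancel' this]
    · simp [Nat.factorization_eq_zero_of_not_prime _ hl]
  rcases Int.natAbs_eq n with h' | h' <;> rw [key] at h'
  · exact ⟨Nat.floorRoot k n.natAbs, by exact_mod_cast h'⟩
  · exact ⟨-Nat.floorRoot k n.natAbs, by rw [hk.neg_pow]; exact_mod_cast h'⟩

lemma exists_eq_powProd_mul_pow {k : ℕ} (hk : Odd k) (L : List (ℕ × ℕ))
    (hL : (L.map Prod.fst).Nodup) (hprime : ∀ a ∈ L, a.1.Prime) {n : ℤ} (hn : n ≠ 0)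
    (hmem : ∀ a ∈ L, padicValInt a.1 n % k = a.2)
    (hnot : ∀ l : ℕ, l.Prime → l ∉ L.map Prod.fst → padicValInt l n % k = 0) :
    ∃ w : ℤ, n = powProd L * w ^ k := by
  induction L generalizing n with
  | nil =>
    obtain ⟨w, hw⟩ := exists_eq_pow_of_dvd_padicValInt hn hk fun l hl =>
      Nat.dvd_of_mod_eq_zero (hnot l hl (by simp))
    exact ⟨w, by simp [powProd, hw]⟩
  | cons a L ih =>
    have : Fact a.1.Prime := ⟨hprime a (by simp)⟩
    have ha0 : (a.1 : ℤ) ≠ 0 := by exact_mod_cast this.out.ne_zero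
    have ha := hmem a (by simp)
    obtain ⟨n, rfl⟩ : (a.1 : ℤ) ^ a.2 ∣ n :=
      (padicValInt_dvd_iff _ _).2 (.inr (ha ▸ Nat.mod_le _ _))
    have hn' : n ≠ 0 := right_ne_zero_of_mul hn
    have hne (l : ℕ) (hl : l.Prime) (hla : l ≠ a.1) :
        padicValInt l ((a.1 : ℤ) ^ a.2 * n) = padicValInt l n := by
      have : Fact l.Prime := ⟨hl⟩
      rw [mul_comm]
      refine padicValInt_mul_of_not_dvd hn' fun h => hla ?_
      exact (Nat.prime_dvd_prime_iff_eq hl (hprime a (by simp))).1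
        (hl.dvd_of_dvd_pow (by exact_mod_cast h))
    rw [List.map_cons, List.nodup_cons] at hL
    obtain ⟨w, hw⟩ := ih hL.2 (fun b hb => hprime b (by simp [hb])) hn'
      (fun b hb => by
        rw [← hne b.1 (hprime b (by simp [hb]))]
        · exact hmem b (by simp [hb])
        · intro h
          exact hL.1 (h ▸ List.mem_map_of_mem hb))
      (fun l hl hl' => by
        by_cases hla : l = a.1
        · subst hla
          rw [padicValInt_pow_mul _ hn'] at ha
          have hlt : a.2 < k := by
            rw [← ha]
            exact Nat.mod_lt _ hk.pos
          have : a.2 + padicValInt a.1 n ≡ a.2 + 0 [MOD k] := by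
            rw [Nat.ModEq, ha, add_zero, Nat.mod_eq_of_lt hlt]
          simpa [Nat.ModEq] using this.add_left_cancel'
        · rw [← hne l hl hla]
          exact hnot l hl (by simp [hla] at hl' ⊢; exact hl'))
    refine ⟨w, ?_⟩
    rw [hw, powProd, powProd, List.map_cons, List.prod_cons]
    ring

/-- The class of a primitive solution: the forms of degrees `3`, `2`, `2` modulo eleventh powers. -/
lemma IsPrimitiveSolution.exists_class {x y z : ℤ} (h : IsPrimitiveSolution x y z) :
    ∃ a ∈ [0, 2, 9], ∃ b ∈ [0, 1, 10], ∃ s ∈ [0, 1, 10], ∃ t ∈ [0, 1, 10],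
    ∃ e₁ ∈ [0, 1, 10], ∃ e₂ ∈ [0, 1, 10], ∃ e₃ ∈ [0, 2, 9], ∃ e₄ ∈ [0, 1, 10], ∃ e₅ ∈ [0, 1, 10],
    ∃ d₁ ∈ [0, 2, 9], ∃ d₂ ∈ [0, 1, 10], ∃ d₃ ∈ [0, 1, 10], ∃ d₄ ∈ [0, 1, 10], ∃ d₅ ∈ [0, 1, 10],
    ∃ d₆ ∈ [0, 4], ∃ w₀ w₁ w₂ : ℤ,
      cubicForm x y = powProd [(1000121, 6), (37, a), (1117, b)] * w₀ ^ 11 ∧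
      normForm 1 1 x y = powProd [(31, s), (409, t), (14389, e₁), (103, e₂), (7, e₃), (13, e₄),
        (37, e₅)] * w₁ ^ 11 ∧
      normForm 67 63 x y = powProd [(37, 10 * a % 11), (1117, 10 * b % 11), (31, 10 * s % 11),
        (409, 10 * t % 11), (67, d₁), (103, d₂), (41983, d₃), (571, d₄), (2251, d₅), (3, d₆)] *
          w₂ ^ 11 := by
  have h0 := cubicForm_ne_zero h.1
  have h1 := normForm_ne_zero (b := 1) (c := 1) (by norm_num) (by norm_num) h.1
  have h2 := normForm_ne_zero (b := 67) (c := 63) (by norm_num) (by norm_num) h.1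
  have p37 := padicValInt_37 h
  have p1117 := padicValInt_1117 h
  have p31 := padicValInt_31 h
  have p409 := padicValInt_409 h
  have p14389 := padicValInt_14389 h
  have p103 := padicValInt_103 h
  have p7 := padicValInt_7 h
  have p13 := padicValInt_13 h
  have p67 := padicValInt_67 h
  have p41983 := padicValInt_41983 h
  have p571 := padicValInt_571 h
  have p2251 := padicValInt_2251 h
  have p3 := padicValInt_three_normForm h
  have p31' := padicValInt_three_normForm_one_one h
  have hp : Fact (Nat.Prime 1000121) := ⟨by norm_num⟩
  have hpn (b c : ℤ) (hbc : ¬ ((1000121 : ℕ) : ℤ) ∣ b * c) :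
      padicValInt 1000121 (normForm b c x y) = 0 :=
    padicValInt_normForm_eq_zero h.1 (by norm_num) hbc
  have hp1 := hpn 1 1 (by norm_num)
  have hp2 := hpn 67 63 (by norm_num)
  have hp0 : padicValInt 1000121 (cubicForm x y) % 11 = 6 := by
    have := padicValInt_sum (l := 1000121) h.1 h.2
    rw [hp1, hp2, hpn 67 166 (by norm_num), hpn 32 135 (by norm_num),
      padicValInt_eq_of_eq_pow_mul (l := 1000121) (n := 1000121) 1 1 (by norm_num)
        (by norm_num)] at this
    omega
  obtain ⟨w₀, hw₀⟩ := exists_eq_powProd_mul_pow (k := 11) (by decide)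
    [(1000121, 6), (37, padicValInt 37 (cubicForm x y) % 11),
      (1117, padicValInt 1117 (cubicForm x y) % 11)] (by simp) (by norm_num) h0 (by simp [hp0])
      (fun l hl hmem => by
        have : Fact l.Prime := ⟨hl⟩
        simp only [List.map_cons, List.map_nil, List.mem_cons, List.not_mem_nil, or_false,
          not_or] at hmem
        have := padicValInt_relations hmem.1 h
        omega)
  obtain ⟨w₁, hw₁⟩ := exists_eq_powProd_mul_pow (k := 11) (by decide)
    [(31, padicValInt 31 (normForm 1 1 x y) % 11), (409, padicValInt 409 (normForm 1 1 x y) % 11),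
      (14389, padicValInt 14389 (normForm 1 1 x y) % 11),
      (103, padicValInt 103 (normForm 1 1 x y) % 11), (7, padicValInt 7 (normForm 1 1 x y) % 11),
      (13, padicValInt 13 (normForm 1 1 x y) % 11), (37, padicValInt 37 (normForm 1 1 x y) % 11)]
      (by simp) (by norm_num) h1 (by simp)
      (fun l hl hmem => by
        have : Fact l.Prime := ⟨hl⟩
        simp only [List.map_cons, List.map_nil, List.mem_cons, List.not_mem_nil, or_false,
          not_or] at hmem
        by_cases hlp : l = 1000121
        · rw [hlp, hp1]
        by_cases hl3 : l = 3
        · rw [hl3, p31']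
        have := padicValInt_relations hlp h
        omega)
  obtain ⟨w₂, hw₂⟩ := exists_eq_powProd_mul_pow (k := 11) (by decide)
    [(37, 10 * (padicValInt 37 (cubicForm x y) % 11) % 11),
      (1117, 10 * (padicValInt 1117 (cubicForm x y) % 11) % 11),
      (31, 10 * (padicValInt 31 (normForm 1 1 x y) % 11) % 11),
      (409, 10 * (padicValInt 409 (normForm 1 1 x y) % 11) % 11),
      (67, padicValInt 67 (normForm 67 63 x y) % 11),
      (103, padicValInt 103 (normForm 67 63 x y) % 11),
      (41983, padicValInt 41983 (normForm 67 63 x y) % 11),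
      (571, padicValInt 571 (normForm 67 63 x y) % 11),
      (2251, padicValInt 2251 (normForm 67 63 x y) % 11),
      (3, padicValInt 3 (normForm 67 63 x y) % 11)]
      (by simp) (by norm_num) h2
      (by
        simp only [List.forall_mem_cons]
        refine ⟨?_, ?_, ?_, ?_, by simp⟩
        · have := p37.2.1
          omega
        · have := p1117.2
          omega
        · have := p31.2
          omega
        · have := p409.2
          omega)
      (fun l hl hmem => by
        have : Fact l.Prime := ⟨hl⟩
        simp only [List.map_cons, List.map_nil, List.mem_cons, List.not_mem_nil, or_false,
          not_or] at hmem
        by_cases hlp : l = 1000121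
        · rw [hlp, hp2]
        have := padicValInt_relations hlp h
        omega)
  exact ⟨_, by simpa using p37.1, _, by simpa using p1117.1, _, by simpa using p31.1,
    _, by simpa using p409.1, _, by simpa using p14389, _, by simpa using p103.1,
    _, by simpa using p7, _, by simpa using p13, _, by simpa using p37.2.2,
    _, by simpa using p67, _, by simpa using p103.2, _, by simpa using p41983,
    _, by simpa using p571, _, by simpa using p2251, _, by simpa using p3,
    w₀, w₁, w₂, hw₀, hw₁, hw₂⟩

/-- Data for a sieve modulo `q` by classes modulo eleventh powers. -/
structure SieveModulus where
  /-- The modulus. -/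
  q : ℕ
  /-- The exponent such that `r ↦ r ^ m` maps the units onto the powers of `g`. -/
  m : ℕ
  /-- An element of order `11`. -/
  g : ℕ
  /-- The logarithms to base `g` of `r ^ m` for `r < q`, as digits in base `16`;
  the digit `15` marks the nonunits. -/
  logs : ℕ
  /-- The bit set of the attained values of `(E₁ + 10E₂) % 11 + 11 * ((2E₀ + 8E₁) % 11)`, where
  `E₀`, `E₁`, `E₂` are the classes of the forms of degrees `3`, `2`, `2`. -/
  mask : ℕ

namespace SieveModulus

/-- The logarithm of `n ^ m` to base `g`. -/
def chi (d : SieveModulus) (n : ℕ) : ℕ := (d.logs >>> (4 * (n % d.q))) % 16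

/-- Whether the classes `e₀`, `e₁`, `e₂` are attained. -/
def attained (d : SieveModulus) (e₀ e₁ e₂ : ℕ) : Prop :=
  ((d.mask >>> (11 * ((2 * e₀ + 8 * e₁) % 11)) % 2048) >>> ((e₁ + 10 * e₂) % 11)) % 2 ≠ 0

instance (d : SieveModulus) (e₀ e₁ e₂ : ℕ) : Decidable (d.attained e₀ e₁ e₂) :=
  inferInstanceAs (Decidable (_ ≠ _))

/-- A natural number congruent to `normForm b c X T` modulo `q`. -/
def normValue (d : SieveModulus) (b c X T : ℕ) : ℕ :=
  b ^ 2 * X ^ 2 + (d.q - 1) * (b * c * X * T) + c ^ 2 * T ^ 2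

/-- The possible classes of `N` such that `N * w ^ 11 = n` modulo `q` for some `w`. -/
def classes (d : SieveModulus) (n : ℕ) : List ℕ :=
  if d.chi n < 11 then [d.chi n] else if n % d.q = 0 then List.range 11 else []

/-- Check that `mask` contains the classes attained at `(X, T)`. -/
def checkPoint (d : SieveModulus) (X T : ℕ) : Bool :=
  (d.classes (X ^ 3 + 11 * T ^ 3)).all fun e₀ =>
  (d.classes (d.normValue 1 1 X T)).all fun e₁ =>
  (d.classes (d.normValue 67 63 X T)).all fun e₂ =>
    d.attained e₀ e₁ e₂ ||
      (d.chi (d.normValue 67 166 X T) < 11 && d.chi (d.normValue 32 135 X T) < 11 &&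
        (e₀ + e₁ + e₂ + d.chi (d.normValue 67 166 X T) + d.chi (d.normValue 32 135 X T)) % 11 !=
          6 * d.chi 1000121 % 11)

/-- Check that the data are correct. -/
def check (d : SieveModulus) : Bool :=
  d.q != 0 && d.m != 0 && d.g ^ 11 % d.q == 1 % d.q && d.g % d.q != 1 % d.q &&
  ([1000121, 37, 1117, 31, 409, 14389, 103, 7, 13, 67, 41983, 571, 2251, 3].all
    fun l => d.chi l < 11) &&
  (List.range d.q).all fun r =>
    (if d.chi r < 11 then r ^ d.m % d.q == d.g ^ d.chi r % d.q
      else r ^ 11 % d.q == 0 && d.checkPoint r 1) && d.checkPoint 1 r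

end SieveModulus

/-- Eleventh power residues modulo `23`. -/
def sieve23 : SieveModulus where
  q := 23
  m := 2
  g := 4
  logs := 29196403568799463048904975
  mask := 633825300114114700748351602688

/-- Eleventh power residues modulo `89`. -/
def sieve89 : SieveModulus where
  q := 89
  m := 8
  g := 78
  logs := 900886587042005513876344959962889823284777100449600082974633262513615103599416123332276014802651759939855
  mask := 5192296877878821910446032860225536

/-- Eleventh power residues modulo `121`. -/
def sieve121 : SieveModulus where
  q := 121
  m := 10
  g := 12
  logs := 983516621519950524296508826324391389911718632333519849050799289876295957491437469591589517678531566732995260675936776356441634937328783364588815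
  mask := 79382905020327933840210297088

/-- Eleventh power residues modulo `331`. -/
def sieve331 : SieveModulus where
  q := 331
  m := 30
  g := 270
  logs := 91176914253899866989190123562012627034155944942298108561684094154439479005850492614784626648522062472701948796927703420277355484460150755993911442192979224366840946443883724475625709500495195749009582697571304609366334974512953481036982853976684110352174958929323176311492779569577415258447150466636881362797819230074272826276477168924860982738160424565043039582401024333566931216313390180864015
  mask := 2046040091961805873261757398280833098

/-- Eleventh power residues modulo `397`. -/
def sieve397 : SieveModulus where
  q := 397
  m := 36
  g := 290
  logs := 58650228151616628607004582496783263121696906347069639399546056966410303709721238843404015997499224677952917192682261724109717330249333784575306318267361614550403683751110208539713587235765748735156010383101689876762489693644370806926087274390193249205991528374896918623283851247657282353532018723241535595839406722873393180135589159199487351106447417605868314310218514501761343113458720440144437283696165614915016213353085120686310173474604396019170284219966189200907804238095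
  mask := 852538598833278202115622817398522001

/-- Eleventh power residues modulo `419`. -/
def sieve419 : SieveModulus where
  q := 419
  m := 38
  g := 334
  logs := 14071733044258681157464079440177340550977298431836405140496609707733565293506736052078180658315303313290700957317127196540620116846961688827490336262927089796635410867080435135035335353043021597917932125989079315757528559257131552239458603736684110390570695425658634806067042158844145115575041582790378133507210164915960822060804197451367546991012618847674792433613367089029453923906654860252358727334869928867698502662337353771684205899212444363060024624480345885529079875511140048733595341347321155855
  mask := 24359199013548463758673996801058828

/-- Eleventh power residues modulo `727`. -/
def sieve727 : SieveModulus where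
  q := 727
  m := 66
  g := 590
  logs := 1100842986450745052599505126758011149963815714058866386598262807701755845702720006640364573287404307255380351970745156634659256004690425407060993922632416449798860209779938365344363565015603106708754695350263973069147648444642593578590401363872204650979193801459588154670242177992338242126343985277046090877660200291827721224260055442334494271073303566806877248242335178768518155653653736128741892558230690753766733221840714755804793828052343620442243454771444248262245524972598339166860699590208156859888552849504371589495492901673449197515887707020629168345690640216307259791252617333497913773799521760266584280715922153275677175172354191123244189465450782987955473925421716835386376406232220017523445266396961592957631326466361146686230496441307840272572791488106523129166107336416869937608392041189025197199504709661152610409573805490892317228466304723089074813413761295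
  mask := 1207281863268129598395548913026815253

/-- The moduli used. -/
def sieveModuli : List SieveModulus :=
  [sieve23, sieve89, sieve121, sieve331, sieve397, sieve419, sieve727]

lemma check_sieveModuli : sieveModuli.all SieveModulus.check = true := by
  decide +kernel

namespace SieveModulus

/-- The sum of the logarithms of the factors of `powProd L`. -/
def logSum (d : SieveModulus) (L : List (ℕ × ℕ)) : ℕ := (L.map fun a => a.2 * d.chi a.1).sum

/-- The logarithms of `n` for all moduli, as digits in base `65536`. -/
def packedLogs (ds : List SieveModulus) (n : ℕ) : ℕ := ds.foldr (fun d t => d.chi n + 65536 * t) 0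

/-- The sums of logarithms for all moduli, as digits in base `65536`. -/
def packedSums (ds : List SieveModulus) (L : List (ℕ × ℕ)) : ℕ :=
  (L.map fun a => a.2 * packedLogs ds a.1).sum

/-- The first class packed in `t`. -/
def firstClass (t : ℕ) : ℕ := (t.mod 65536).mod 11

/-- The parts of the bit sets belonging to the values of `2E₀ + 8E₁` packed in `t`. -/
def rows (ds : List SieveModulus) : ℕ → List ℕ :=
  ds.rec (fun _ => []) fun d _ ih t =>
    (d.mask.shiftRight (Nat.mul 11 (firstClass t))).mod 2048 :: ih (t.div 65536)

/-- Whether one of the rows is empty. -/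
def hasEmpty (R : List ℕ) : Bool := R.rec false fun r _ ih => r.rec true fun _ _ => ih

/-- Whether one of the rows does not contain the corresponding class packed in `t`. -/
def refutes (R : List ℕ) : ℕ → Bool :=
  R.rec (fun _ => false) fun r _ ih t =>
    ((r.shiftRight (firstClass t)).mod 2).rec true fun _ _ => ih (t.div 65536)

/-- Whether `P` holds for all sums of `t` and a multiple `e * w` for each `(w, E) ∈ L`, `e ∈ E`. -/
def allSums (P : ℕ → Bool) (L : List (ℕ × List ℕ)) : ℕ → Bool :=
  L.rec P fun a _ ih t => a.2.rec true fun e _ ih' => (ih (t.add (e.mul a.1))).rec false ih'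

/-- Check that every class of primitive solutions is excluded by one of the moduli. -/
def search (ds : List SieveModulus) (w : ℕ → ℕ) : Bool :=
  [0, 2, 9].all fun a => [0, 1, 10].all fun b => [0, 1, 10].all fun s => [0, 1, 10].all fun t =>
    allSums
      (fun t₁ =>
        let R := rows ds (2 * packedSums ds [(1000121, 6), (37, a), (1117, b)] + 8 * t₁)
        hasEmpty R ||
        allSums (refutes R)
          [(10 * w 67, [0, 2, 9]), (10 * w 103, [0, 1, 10]), (10 * w 41983, [0, 1, 10]),
            (10 * w 571, [0, 1, 10]), (10 * w 2251, [0, 1, 10]), (10 * w 3, [0, 4])]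
          (t₁ + 10 * packedSums ds [(37, 10 * a % 11), (1117, 10 * b % 11), (31, 10 * s % 11),
            (409, 10 * t % 11)]))
      [(w 14389, [0, 1, 10]), (w 103, [0, 1, 10]), (w 7, [0, 2, 9]), (w 13, [0, 1, 10]),
        (w 37, [0, 1, 10])]
      (packedSums ds [(31, s), (409, t)])

end SieveModulus

lemma search_sieveModuli :
    SieveModulus.search sieveModuli (SieveModulus.packedLogs sieveModuli) = true := by
  decide +kernel

namespace SieveModulus

variable {d : SieveModulus}

/-- `z` has class `k` modulo eleventh powers. -/
def HasClass (d : SieveModulus) (z : ZMod d.q) (k : ℕ) : Prop := z ^ d.m = (d.g : ZMod d.q) ^ k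

lemma HasClass.mul {z z' : ZMod d.q} {k k' : ℕ} (h : d.HasClass z k) (h' : d.HasClass z' k') :
    d.HasClass (z * z') (k + k') := by
  rw [HasClass, mul_pow, h, h', pow_add]

lemma HasClass.pow {z : ZMod d.q} {k : ℕ} (h : d.HasClass z k) (n : ℕ) :
    d.HasClass (z ^ n) (n * k) := by
  rw [HasClass, pow_right_comm, h, ← pow_mul, mul_comm]

/-- The consequences of `check`. -/
lemma of_check (h : d.check = true) :
    d.q ≠ 0 ∧ d.m ≠ 0 ∧ (d.g : ZMod d.q) ^ 11 = 1 ∧ (d.g : ZMod d.q) ≠ 1 ∧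
    (∀ l ∈ [1000121, 37, 1117, 31, 409, 14389, 103, 7, 13, 67, 41983, 571, 2251, 3],
      d.chi l < 11) ∧
    (∀ r < d.q, if d.chi r < 11 then d.HasClass r (d.chi r)
      else (r : ZMod d.q) ^ 11 = 0 ∧ d.checkPoint r 1) ∧
    ∀ r < d.q, d.checkPoint 1 r := by
  simp only [check, Bool.and_eq_true, bne_iff_ne, ne_eq, beq_iff_eq, List.all_eq_true,
    List.mem_range, decide_eq_true_eq] at h
  obtain ⟨⟨⟨⟨⟨hq, hm⟩, hg⟩, hg1⟩, hl⟩, hr⟩ := h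
  refine ⟨hq, hm, ?_, ?_, hl, fun r hrq => ?_, fun r hrq => (hr r hrq).2⟩
  · exact_mod_cast (ZMod.natCast_eq_natCast_iff' _ _ _).2 hg
  · exact_mod_cast mt (ZMod.natCast_eq_natCast_iff' _ _ _).1 hg1
  · have := (hr r hrq).1
    split_ifs at this ⊢ with hc
    · rw [beq_iff_eq] at this
      unfold HasClass
      exact_mod_cast (ZMod.natCast_eq_natCast_iff' _ _ _).2 this
    · rw [Bool.and_eq_true, beq_iff_eq] at this
      refine ⟨?_, this.2⟩
      rw [← Nat.cast_pow, ZMod.natCast_eq_zero_iff]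
      exact Nat.dvd_of_mod_eq_zero this.1

lemma isUnit_g (h : d.check = true) : IsUnit (d.g : ZMod d.q) :=
  IsUnit.of_pow_eq_one (of_check h).2.2.1 (by norm_num)

lemma nontrivial_of_check (h : d.check = true) : Nontrivial (ZMod d.q) :=
  ⟨⟨_, _, (of_check h).2.2.2.1⟩⟩

lemma HasClass.isUnit (h : d.check = true) {z : ZMod d.q} {k : ℕ} (hz : d.HasClass z k) :
    IsUnit z :=
  (isUnit_pow_iff (of_check h).2.1).1 (hz ▸ (isUnit_g h).pow k)

lemma HasClass.mod_eq (h : d.check = true) {z : ZMod d.q} {k k' : ℕ} (hz : d.HasClass z k)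
    (hz' : d.HasClass z k') : k % 11 = k' % 11 := by
  obtain ⟨u, hu⟩ := isUnit_g h
  have h11 : Fact (Nat.Prime 11) := ⟨by norm_num⟩
  have ho : orderOf u = 11 := by
    refine orderOf_eq_prime ?_ ?_
    · have := (of_check h).2.2.1
      rw [← hu] at this
      exact Units.ext (by push_cast; exact this)
    · rintro rfl
      exact (of_check h).2.2.2.1 hu.symm
  have e := hz.symm.trans hz'
  rw [← hu, ← Units.val_pow_eq_pow_val, ← Units.val_pow_eq_pow_val, Units.val_inj,
    pow_eq_pow_iff_modEq, ho] at e
  exact e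

lemma hasClass_or_pow_eq_zero (h : d.check = true) (n : ℕ) :
    (d.chi n < 11 ∧ d.HasClass n (d.chi n)) ∨ (¬ d.chi n < 11 ∧ (n : ZMod d.q) ^ 11 = 0) := by
  have hr := (of_check h).2.2.2.2.2.1 (n % d.q) (Nat.mod_lt _ (Nat.pos_of_ne_zero (of_check h).1))
  have hc : d.chi (n % d.q) = d.chi n := by rw [chi, Nat.mod_mod, chi]
  rw [hc, ZMod.natCast_mod] at hr
  split_ifs at hr with hn
  · exact .inl ⟨hn, hr⟩
  · exact .inr ⟨hn, hr.1⟩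

lemma exists_hasClass_or_pow_eq_zero (h : d.check = true) (z : ZMod d.q) :
    (∃ k, d.HasClass z k) ∨ z ^ 11 = 0 := by
  have : NeZero d.q := ⟨(of_check h).1⟩
  rw [← ZMod.natCast_zmod_val z]
  exact (hasClass_or_pow_eq_zero h z.val).imp (fun h => ⟨_, h.2⟩) And.right

lemma hasClass_chi (h : d.check = true) {n : ℕ} (hn : d.chi n < 11) :
    d.HasClass n (d.chi n) :=
  ((hasClass_or_pow_eq_zero h n).resolve_right fun h => h.1 hn).2

lemma hasClass_powProd (h : d.check = true) {L : List (ℕ × ℕ)}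
    (hL : ∀ a ∈ L, d.chi a.1 < 11) : d.HasClass (powProd L : ℤ) (d.logSum L) := by
  induction L with
  | nil => simp [HasClass, powProd, logSum]
  | cons a L ih =>
    have ha := (hasClass_chi h (hL a (by simp))).pow a.2
    have := ha.mul (ih fun b hb => hL b (by simp [hb]))
    simpa [powProd, logSum] using this

/-- A class `k` with `N * w ^ 11 = n` for some `N` of class `k` is recorded in `classes`. -/
lemma mem_classes (h : d.check = true) {n k : ℕ} {N w : ZMod d.q} (hN : d.HasClass N k)
    (hn : N * w ^ 11 = n) : k % 11 ∈ d.classes n := by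
  have := nontrivial_of_check h
  unfold classes
  rcases exists_hasClass_or_pow_eq_zero h w with ⟨j, hw⟩ | hw
  · have hc := hN.mul (hw.pow 11)
    rw [hn] at hc
    rcases hasClass_or_pow_eq_zero h n with ⟨hlt, hn'⟩ | ⟨-, hn'⟩
    · rw [if_pos hlt, List.mem_singleton, ← Nat.mod_eq_of_lt hlt, ← hc.mod_eq h hn']
      omega
    · exact absurd hn' ((hc.isUnit h).pow 11).ne_zero
  · rw [hw, mul_zero] at hn
    rcases hasClass_or_pow_eq_zero h n with ⟨hlt, hn'⟩ | ⟨hlt, -⟩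
    · rw [← hn] at hn'
      exact absurd (hn'.isUnit h) not_isUnit_zero
    · rw [if_neg hlt, if_pos, List.mem_range]
      · exact Nat.mod_lt _ (by norm_num)
      · exact Nat.mod_eq_zero_of_dvd ((ZMod.natCast_eq_zero_iff _ _).1 hn.symm)

end SieveModulus

namespace SieveModulus

variable {d : SieveModulus}

lemma natCast_normValue (h : d.check = true) (b c X T : ℕ) :
    (d.normValue b c X T : ZMod d.q) = b ^ 2 * X ^ 2 - b * c * X * T + c ^ 2 * T ^ 2 := by
  rw [normValue]
  push_cast [Nat.cast_pred (Nat.pos_of_ne_zero (of_check h).1)]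
  rw [ZMod.natCast_self]
  ring

/-- Every point of the projective line modulo `q` has been checked. -/
lemma exists_checkPoint (h : d.check = true) {x y : ℤ} (hxy : IsCoprime x y) :
    ∃ (u : ZMod d.q) (k X T : ℕ), d.HasClass u k ∧ u * x = X ∧ u * y = T ∧ d.checkPoint X T := by
  have hq := of_check h
  have := nontrivial_of_check h
  have : NeZero d.q := ⟨hq.1⟩
  have inv {a : ZMod d.q} (ha : a ^ 11 ≠ 0) : ∃ u k, d.HasClass u k ∧ u * a = 1 := by
    obtain ⟨k, hk⟩ := (exists_hasClass_or_pow_eq_zero h a).resolve_right ha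
    obtain ⟨u, hu⟩ := (hk.isUnit h).exists_left_inv
    rcases exists_hasClass_or_pow_eq_zero h u with ⟨j, hj⟩ | hu'
    · exact ⟨u, j, hj, hu⟩
    · exact absurd (congrArg (· ^ 11) hu) (by simp [mul_pow, hu'])
  by_cases hx : (x : ZMod d.q) ^ 11 = 0
  · have hy : (y : ZMod d.q) ^ 11 ≠ 0 := fun hy => by
      obtain ⟨a, b, hab⟩ := (hxy.map (Int.castRingHom (ZMod d.q))).pow (m := 11) (n := 11)
      simp [hx, hy] at hab
    obtain ⟨u, k, hu, huy⟩ := inv hy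
    refine ⟨u, k, (u * x).val, 1, hu, (ZMod.natCast_zmod_val _).symm, by simpa using huy, ?_⟩
    have hr := hq.2.2.2.2.2.1 (u * x).val (ZMod.val_lt _)
    split_ifs at hr
    · have h0 := (hr.isUnit h).pow 11
      rw [ZMod.natCast_zmod_val, mul_pow, hx, mul_zero] at h0
      exact absurd h0 not_isUnit_zero
    · exact hr.2
  · obtain ⟨u, k, hu, hux⟩ := inv hx
    exact ⟨u, k, 1, (u * y).val, hu, by simpa using hux, (ZMod.natCast_zmod_val _).symm,
      hq.2.2.2.2.2.2 _ (ZMod.val_lt _)⟩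

lemma attained_of_eq (h : d.check = true) {x y z w₀ w₁ w₂ : ℤ} {L₀ L₁ L₂ : List (ℕ × ℕ)}
    (hxy : IsCoprime x y) (hL₀ : ∀ a ∈ L₀, d.chi a.1 < 11) (hL₁ : ∀ a ∈ L₁, d.chi a.1 < 11)
    (hL₂ : ∀ a ∈ L₂, d.chi a.1 < 11) (h₀ : cubicForm x y = powProd L₀ * w₀ ^ 11)
    (h₁ : normForm 1 1 x y = powProd L₁ * w₁ ^ 11)
    (h₂ : normForm 67 63 x y = powProd L₂ * w₂ ^ 11)
    (hz : powProd L₀ * powProd L₁ * powProd L₂ * normForm 67 166 x y * normForm 32 135 x y =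
      1000121 ^ 6 * z ^ 11) :
    d.attained (d.logSum L₀) (d.logSum L₁) (d.logSum L₂) := by
  obtain ⟨u, k, X, T, hu, hX, hT, hc⟩ := exists_checkPoint h hxy
  have c₀ := (hasClass_powProd h hL₀).mul (hu.pow 3)
  have c₁ := (hasClass_powProd h hL₁).mul (hu.pow 2)
  have c₂ := (hasClass_powProd h hL₂).mul (hu.pow 2)
  have cubic : (powProd L₀ * u ^ 3) * (w₀ : ZMod d.q) ^ 11 = (X ^ 3 + 11 * T ^ 3 : ℕ) := by
    have := congrArg (Int.cast : ℤ → ZMod d.q) h₀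
    push_cast [cubicForm] at this ⊢
    rw [← hX, ← hT]
    linear_combination -u ^ 3 * this
  have norm (b c : ℕ) : (normForm b c x y : ZMod d.q) * u ^ 2 = d.normValue b c X T := by
    rw [natCast_normValue h, ← hX, ← hT, normForm]
    push_cast
    ring
  have norm' {b c : ℕ} {L : List (ℕ × ℕ)} {w : ℤ} (e : normForm b c x y = powProd L * w ^ 11) :
      (powProd L * u ^ 2) * (w : ZMod d.q) ^ 11 = d.normValue b c X T := by
    rw [← norm, e]
    push_cast
    ring
  simp only [checkPoint, List.all_eq_true] at hc
  have := hc _ (mem_classes h c₀ cubic) _ (mem_classes h c₁ (norm' h₁)) _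
    (mem_classes h c₂ (norm' h₂))
  rw [Bool.or_eq_true, decide_eq_true_eq] at this
  rcases this with this | this
  · unfold attained at this ⊢
    rwa [show (2 * ((d.logSum L₀ + 3 * k) % 11) + 8 * ((d.logSum L₁ + 2 * k) % 11)) % 11 =
      (2 * d.logSum L₀ + 8 * d.logSum L₁) % 11 by omega,
      show ((d.logSum L₁ + 2 * k) % 11 + 10 * ((d.logSum L₂ + 2 * k) % 11)) % 11 =
      (d.logSum L₁ + 10 * d.logSum L₂) % 11 by omega] at this
  · simp only [Bool.and_eq_true, decide_eq_true_eq, bne_iff_ne] at this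
    obtain ⟨⟨h3, h4⟩, hne⟩ := this
    refine absurd ?_ hne
    have hp := (hasClass_chi h ((of_check h).2.2.2.2.1 1000121 (by simp))).pow 6
    have hl := ((c₀.mul c₁).mul c₂).mul ((hasClass_chi h h3).mul (hasClass_chi h h4))
    have e : (powProd L₀ * u ^ 3) * (powProd L₁ * u ^ 2) * (powProd L₂ * u ^ 2) *
        (d.normValue 67 166 X T * d.normValue 32 135 X T) =
          ((1000121 : ℕ) : ZMod d.q) ^ 6 * (z * u) ^ 11 := by
      have := congrArg (Int.cast : ℤ → ZMod d.q) hz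
      rw [← norm, ← norm]
      push_cast at this ⊢
      linear_combination u ^ 11 * this
    rw [e] at hl
    have hu : IsUnit ((z * u : ZMod d.q) ^ 11) := isUnit_of_mul_isUnit_right (hl.isUnit h)
    obtain ⟨j, hj⟩ := (exists_hasClass_or_pow_eq_zero h (z * u)).resolve_right fun h0 => by
      have := nontrivial_of_check h
      exact not_isUnit_zero (h0 ▸ hu)
    have := (hp.mul (hj.pow 11)).mod_eq h hl
    omega

end SieveModulus

namespace SieveModulus

lemma logSum_le (d : SieveModulus) (L : List (ℕ × ℕ)) :
    d.logSum L ≤ 15 * (L.map Prod.snd).sum := by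
  induction L with
  | nil => simp [logSum]
  | cons a L ih =>
    have : d.chi a.1 ≤ 15 := Nat.le_of_lt_succ (Nat.mod_lt _ (by norm_num))
    simp only [logSum, List.map_cons, List.sum_cons] at ih ⊢
    nlinarith [Nat.mul_le_mul_left a.2 this]

lemma packedSums_cons (d : SieveModulus) (ds : List SieveModulus) (L : List (ℕ × ℕ)) :
    packedSums (d :: ds) L = d.logSum L + 65536 * packedSums ds L := by
  induction L with
  | nil => simp [logSum, packedSums]
  | cons a L ih =>
    simp only [packedSums, logSum, List.map_cons, List.sum_cons] at ih ⊢
    rw [ih, packedLogs, List.foldr_cons, ← packedLogs]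
    ring

lemma refutes_cons (r : ℕ) (R : List ℕ) (t : ℕ) :
    refutes (r :: R) t = true ↔
      (r >>> firstClass t) % 2 = 0 ∨ refutes R (t / 65536) = true := by
  change Nat.rec true (fun _ _ => refutes R (t / 65536)) ((r >>> firstClass t) % 2) = true ↔ _
  rcases (r >>> firstClass t) % 2 <;> simp

lemma refutes_of_hasEmpty {R : List ℕ} (h : hasEmpty R = true) (t : ℕ) : refutes R t = true := by
  induction R generalizing t with
  | nil => cases h
  | cons r R ih =>
    rw [refutes_cons]
    rcases r with - | r
    · simp
    · exact .inr (ih h _)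

lemma allSums_cons (P : ℕ → Bool) (w : ℕ) (E : List ℕ) (L : List (ℕ × List ℕ)) (t : ℕ) :
    allSums P ((w, E) :: L) t = true ↔ ∀ e ∈ E, allSums P L (t + e * w) = true := by
  induction E with
  | nil => simp [allSums]
  | cons e E ih =>
    rw [List.forall_mem_cons, ← ih]
    change Bool.rec false (allSums P ((w, E) :: L) t) (allSums P L (t + e * w)) = true ↔ _
    cases allSums P L (t + e * w) <;> simp

lemma exists_not_attained {ds : List SieveModulus} {L₀ L₁ L₂ : List (ℕ × ℕ)}
    (h₀ : (L₀.map Prod.snd).sum ≤ 100) (h₁ : (L₁.map Prod.snd).sum ≤ 100)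
    (h₂ : (L₂.map Prod.snd).sum ≤ 100)
    (h : refutes (rows ds (2 * packedSums ds L₀ + 8 * packedSums ds L₁))
      (packedSums ds L₁ + 10 * packedSums ds L₂) = true) :
    ∃ d ∈ ds, ¬ d.attained (d.logSum L₀) (d.logSum L₁) (d.logSum L₂) := by
  induction ds with
  | nil => cases h
  | cons d ds ih =>
    have l₀ := d.logSum_le L₀
    have l₁ := d.logSum_le L₁
    have l₂ := d.logSum_le L₂
    change refutes (((d.mask >>> (11 * firstClass _)) % 2048) :: rows ds (_ / 65536)) _ = true at h
    simp only [refutes_cons, packedSums_cons] at h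
    rcases h with h | h
    · refine ⟨d, by simp, ?_⟩
      change ((d.mask >>> (11 * (_ % 65536 % 11)) % 2048) >>> (_ % 65536 % 11)) % 2 = 0 at h
      rw [show ∀ a b, (2 * (d.logSum L₀ + 65536 * a) + 8 * (d.logSum L₁ + 65536 * b)) % 65536 =
          2 * d.logSum L₀ + 8 * d.logSum L₁ by omega,
        show ∀ a b, (d.logSum L₁ + 65536 * a + 10 * (d.logSum L₂ + 65536 * b)) % 65536 =
          d.logSum L₁ + 10 * d.logSum L₂ by omega] at h
      exact not_not.2 h
    · obtain ⟨d', hd', hd⟩ := ih (by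
        convert h using 3 <;> omega)
      exact ⟨d', by simp [hd'], hd⟩

end SieveModulus

lemma exists_quotient_eq {x y z w₀ w₁ w₂ : ℤ} {L₀ L₁ L₂ : List (ℕ × ℕ)}
    (h : IsPrimitiveSolution x y z) (h₀ : cubicForm x y = powProd ((1000121, 6) :: L₀) * w₀ ^ 11)
    (h₁ : normForm 1 1 x y = powProd L₁ * w₁ ^ 11)
    (h₂ : normForm 67 63 x y = powProd L₂ * w₂ ^ 11) :
    ∃ z' : ℤ, powProd ((1000121, 6) :: L₀) * powProd L₁ * powProd L₂ * normForm 67 166 x y *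
      normForm 32 135 x y = 1000121 ^ 6 * z' ^ 11 := by
  have hw₀ : w₀ ≠ 0 := by
    rintro rfl
    exact cubicForm_ne_zero h.1 (by simp [h₀])
  have hw₁ : w₁ ≠ 0 := by
    rintro rfl
    exact normForm_ne_zero (b := 1) (c := 1) (by norm_num) (by norm_num) h.1 (by simp [h₁])
  have hw₂ : w₂ ≠ 0 := by
    rintro rfl
    exact normForm_ne_zero (b := 67) (c := 63) (by norm_num) (by norm_num) h.1 (by simp [h₂])
  have hp : powProd ((1000121, 6) :: L₀) = 1000121 ^ 6 * powProd L₀ := by simp [powProd]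
  have hz : (w₀ * w₁ * w₂) ^ 11 * (powProd L₀ * powProd L₁ * powProd L₂ * normForm 67 166 x y *
      normForm 32 135 x y) = z ^ 11 := by
    have := h.2
    rw [h₀, h₁, h₂, hp] at this
    refine mul_left_cancel₀ (pow_ne_zero 6 (by norm_num : (1000121 : ℤ) ≠ 0)) ?_
    linear_combination this
  obtain ⟨z', rfl⟩ := (Int.pow_dvd_pow_iff (by norm_num)).1 (Dvd.intro _ hz)
  refine ⟨z', ?_⟩
  have := mul_left_cancel₀ (pow_ne_zero 11 (mul_ne_zero (mul_ne_zero hw₀ hw₁) hw₂))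
    (hz.trans (mul_pow _ _ _))
  rw [hp]
  linear_combination 1000121 ^ 6 * this

lemma SieveModulus.refutes_of_search {ds : List SieveModulus}
    (h : SieveModulus.search ds (SieveModulus.packedLogs ds) = true)
    {a b s t e₁ e₂ e₃ e₄ e₅ d₁ d₂ d₃ d₄ d₅ d₆ : ℕ} (ha : a ∈ [0, 2, 9]) (hb : b ∈ [0, 1, 10])
    (hs : s ∈ [0, 1, 10]) (ht : t ∈ [0, 1, 10]) (he₁ : e₁ ∈ [0, 1, 10]) (he₂ : e₂ ∈ [0, 1, 10])
    (he₃ : e₃ ∈ [0, 2, 9]) (he₄ : e₄ ∈ [0, 1, 10]) (he₅ : e₅ ∈ [0, 1, 10])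
    (hd₁ : d₁ ∈ [0, 2, 9]) (hd₂ : d₂ ∈ [0, 1, 10]) (hd₃ : d₃ ∈ [0, 1, 10])
    (hd₄ : d₄ ∈ [0, 1, 10]) (hd₅ : d₅ ∈ [0, 1, 10]) (hd₆ : d₆ ∈ [0, 4]) :
    SieveModulus.refutes (SieveModulus.rows ds
      (2 * SieveModulus.packedSums ds [(1000121, 6), (37, a), (1117, b)] +
        8 * SieveModulus.packedSums ds [(31, s), (409, t), (14389, e₁), (103, e₂),
          (7, e₃), (13, e₄), (37, e₅)]))
      (SieveModulus.packedSums ds [(31, s), (409, t), (14389, e₁), (103, e₂),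
          (7, e₃), (13, e₄), (37, e₅)] +
        10 * SieveModulus.packedSums ds [(37, 10 * a % 11), (1117, 10 * b % 11),
          (31, 10 * s % 11), (409, 10 * t % 11), (67, d₁), (103, d₂), (41983, d₃), (571, d₄),
          (2251, d₅), (3, d₆)]) = true := by
  simp only [SieveModulus.search, List.all_eq_true] at h
  have hst := h a ha b hb s hs t ht
  simp only [SieveModulus.allSums_cons] at hst
  have hr := hst e₁ he₁ e₂ he₂ e₃ he₃ e₄ he₄ e₅ he₅
  have hT : SieveModulus.packedSums ds [(31, s), (409, t), (14389, e₁), (103, e₂),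
      (7, e₃), (13, e₄), (37, e₅)] =
      SieveModulus.packedSums ds [(31, s), (409, t)] +
        e₁ * SieveModulus.packedLogs ds 14389 + e₂ * SieveModulus.packedLogs ds 103 +
        e₃ * SieveModulus.packedLogs ds 7 + e₄ * SieveModulus.packedLogs ds 13 +
        e₅ * SieveModulus.packedLogs ds 37 := by
    simp only [SieveModulus.packedSums, List.map_cons, List.map_nil, List.sum_cons, List.sum_nil]
    ring
  rw [← hT] at hr
  rcases (Bool.or_eq_true _ _).mp hr with hr | hr
  · exact SieveModulus.refutes_of_hasEmpty hr _
  · simp only [SieveModulus.allSums_cons] at hr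
    convert hr d₁ hd₁ d₂ hd₂ d₃ hd₃ d₄ hd₄ d₅ hd₅ d₆ hd₆ using 1
    change _ = SieveModulus.refutes _ _
    congr 1
    simp only [SieveModulus.packedSums, List.map_cons, List.map_nil, List.sum_cons, List.sum_nil]
    ring

lemma not_isPrimitiveSolution (x y z : ℤ) : ¬ IsPrimitiveSolution x y z := by
  intro h
  obtain ⟨a, ha, b, hb, s, hs, t, ht, e₁, he₁, e₂, he₂, e₃, he₃, e₄, he₄, e₅, he₅, d₁, hd₁, d₂,
    hd₂, d₃, hd₃, d₄, hd₄, d₅, hd₅, d₆, hd₆, w₀, w₁, w₂, h₀, h₁, h₂⟩ := h.exists_class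
  obtain ⟨z', hz⟩ := exists_quotient_eq h h₀ h₁ h₂
  have hr := SieveModulus.refutes_of_search search_sieveModuli ha hb hs ht he₁ he₂ he₃ he₄ he₅
    hd₁ hd₂ hd₃ hd₄ hd₅ hd₆
  have m₁ : ∀ n ∈ [0, 1, 10], n ≤ 10 := by decide
  have m₂ : ∀ n ∈ [0, 2, 9], n ≤ 10 := by decide
  have m₃ : ∀ n ∈ [0, 4], n ≤ 10 := by decide
  replace ha := m₂ a ha
  replace hb := m₁ b hb
  replace hs := m₁ s hs
  replace ht := m₁ t ht
  replace he₁ := m₁ e₁ he₁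
  replace he₂ := m₁ e₂ he₂
  replace he₃ := m₂ e₃ he₃
  replace he₄ := m₁ e₄ he₄
  replace he₅ := m₁ e₅ he₅
  replace hd₁ := m₂ d₁ hd₁
  replace hd₂ := m₁ d₂ hd₂
  replace hd₃ := m₁ d₃ hd₃
  replace hd₄ := m₁ d₄ hd₄
  replace hd₅ := m₁ d₅ hd₅
  replace hd₆ := m₃ d₆ hd₆
  obtain ⟨d, hd, hna⟩ := SieveModulus.exists_not_attained
    (by simp only [List.map_cons, List.map_nil, List.sum_cons, List.sum_nil]; omega)
    (by simp only [List.map_cons, List.map_nil, List.sum_cons, List.sum_nil]; omega)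
    (by simp only [List.map_cons, List.map_nil, List.sum_cons, List.sum_nil]; omega) hr
  have hc := List.all_eq_true.1 check_sieveModuli d hd
  have hl := (SieveModulus.of_check hc).2.2.2.2.1
  exact hna (SieveModulus.attained_of_eq hc h.1
    (by simp only [List.forall_mem_cons] at hl ⊢; simp [hl])
    (by simp only [List.forall_mem_cons] at hl ⊢; simp [hl])
    (by simp only [List.forall_mem_cons] at hl ⊢; simp [hl]) h₀ h₁ h₂ hz)

/-- The degree-11 example:
`(X³+11Y³)(X²-XY+Y²)(67²X²-67·63XY+63²Y²)(67²X²-67·166XY+166²Y²)(32²X²-32·135XY+135²Y²)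
 = 1000121⁶ Z¹¹` defines a non-singular plane projective curve of degree 11 which
violates the local-global principle. -/
theorem degree_eleven_example :
    ViolatesLGP 11 (1000121 ^ 6) 11 ![(1, -1), (67, -63), (-67, 166), (32, -135)] ∧
    (curvePoly 11 (1000121 ^ 6) 11
      ![(1, -1), (67, -63), (-67, 166), (32, -135)]).totalDegree = 11 ∧
    IsNonsingular (curvePoly 11 (1000121 ^ 6) 11
      ![(1, -1), (67, -63), (-67, 166), (32, -135)]) := by
  refine ⟨⟨exists_real_solution, fun l _ => exists_padic_solution l, fun X Y Z h => ?_⟩,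
    totalDegree_curvePoly, isNonsingular_curvePoly⟩
  by_contra h₀
  obtain ⟨x, y, z, hp⟩ := exists_primitive_solution h₀ h
  exact not_isPrimitiveSolution x y z hp
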